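/- For all fixed k and d there is a constant C (depending only on k and d) such that: for every k-local Hamiltonian H = ∑_{e∈E} h_e on n qudits of local dimension d (with no bound assumed on the ‖h_e‖_∞), every n-qudit density matrix ρ, and every integer 1 ≤ l < n, there exists a separable state σ with |Tr[Hρ] − Tr[Hσ]| ≤ C·( (l/n)·|J|_1 + (n^{k/2}/√l)·‖J‖_F ), where J is the array of interaction strengths J_e = ‖h_e‖_∞. -/

import Mathlib

open scoped BigOperators ComplexOrder

noncomputable section

namespace QLH

/-- The operator (spectral) norm of a square complex matrix. -/
def opNorm {m : Type*} [Fintype m] [DecidableEq m] (A : Matrix m m ℂ) : ℝ :=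
  ‖Matrix.toEuclideanCLM (𝕜 := ℂ) A‖

/-- A density matrix: positive semidefinite with unit trace. -/
def IsDensity {m : Type*} [Fintype m] (ρ : Matrix m m ℂ) : Prop :=
  ρ.PosSemidef ∧ ρ.trace = 1

/-- The (real) energy `Tr[Hρ]`. -/
def energy {m : Type*} [Fintype m] (H ρ : Matrix m m ℂ) : ℝ :=
  ((H * ρ).trace).re

/-- Von Neumann entropy via eigenvalues. -/
def entropy {m : Type*} [Fintype m] [DecidableEq m] (ρ : Matrix m m ℂ) : ℝ :=
  if h : ρ.IsHermitian then -∑ i, h.eigenvalues i * Real.log (h.eigenvalues i) else 0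

/-- The free-energy functional at inverse temperature `β`. -/
def freeEnergyFun {m : Type*} [Fintype m] [DecidableEq m] (β : ℝ) (H ρ : Matrix m m ℂ) : ℝ :=
  energy H ρ - entropy ρ / β

/-- The free energy: the infimum of the free-energy functional over density matrices. -/
def freeEnergy {m : Type*} [Fintype m] [DecidableEq m] (β : ℝ) (H : Matrix m m ℂ) : ℝ :=
  sInf {x : ℝ | ∃ ρ, IsDensity ρ ∧ x = freeEnergyFun β H ρ}

/-- `A` acts (nontrivially) only on the sites in `e`. -/
def ActsOn {n : ℕ} {α : Type*} [Fintype α] [DecidableEq α]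
    (A : Matrix (Fin n → α) (Fin n → α) ℂ) (e : Finset (Fin n)) : Prop :=
  ∃ M : Matrix ({u // u ∈ e} → α) ({u // u ∈ e} → α) ℂ,
    ∀ x y, A x y =
      (if ∀ u ∉ e, x u = y u then (1 : ℂ) else 0) *
        M (fun u => x u.1) (fun u => y u.1)

/-- Tensor-product (product) state built from single-site matrices. -/
def prodState {n : ℕ} {α : Type*} [Fintype α] (σ : Fin n → Matrix α α ℂ) :
    Matrix (Fin n → α) (Fin n → α) ℂ :=
  fun x y => ∏ u, σ u (x u) (y u)

/-- A separable state: a finite convex combination of product states. -/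
def IsSeparable {n : ℕ} {α : Type*} [Fintype α] [DecidableEq α]
    (σ : Matrix (Fin n → α) (Fin n → α) ℂ) : Prop :=
  ∃ (N : ℕ) (p : Fin N → ℝ) (τ : Fin N → Fin n → Matrix α α ℂ),
    (∀ i, 0 ≤ p i) ∧ (∑ i, p i = 1) ∧ (∀ i u, IsDensity (τ i u)) ∧
    σ = ∑ i, (p i : ℂ) • prodState (τ i)
section Classical
variable {Ω B B' A : Type*} [Fintype Ω] [Fintype B] [Fintype B'] [Fintype A]

open Classical in
/-- Weight of an event. -/
def pr (P : Ω → ℝ) (Q : Ω → Prop) : ℝ := ∑ x, if Q x then P x else 0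

lemma pr_nonneg {P : Ω → ℝ} (hP : ∀ x, 0 ≤ P x) (Q : Ω → Prop) : 0 ≤ pr P Q := by
  classical
  unfold pr
  exact Finset.sum_nonneg fun x _ => by split_ifs <;> simp [hP]

lemma pr_mono {P : Ω → ℝ} (hP : ∀ x, 0 ≤ P x) {Q R : Ω → Prop} (h : ∀ x, Q x → R x) :
    pr P Q ≤ pr P R := by
  classical
  unfold pr
  refine Finset.sum_le_sum fun x _ => ?_
  by_cases hq : Q x
  · simp [hq, h x hq]
  · simp only [hq, if_false]; split_ifs <;> simp [hP]

lemma pr_congr (P : Ω → ℝ) {Q R : Ω → Prop} (h : ∀ x, Q x ↔ R x) : pr P Q = pr P R := by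
  have : Q = R := funext fun x => propext (h x)
  rw [this]

lemma pr_sum_mul (P : Ω → ℝ) (Q : Ω → Prop) (Z : Ω → B) (g : B → ℝ) :
    ∑ b, pr P (fun x => Q x ∧ Z x = b) * g b = by
      classical exact ∑ x, if Q x then P x * g (Z x) else 0 := by
  classical
  unfold pr
  simp only [Finset.sum_mul]
  rw [Finset.sum_comm]
  refine Finset.sum_congr rfl fun x _ => ?_
  by_cases hq : Q x <;> simp [hq]

lemma pr_sum (P : Ω → ℝ) (Q : Ω → Prop) (Z : Ω → B) :
    ∑ b, pr P (fun x => Q x ∧ Z x = b) = pr P Q := by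
  have := pr_sum_mul P Q Z (fun _ => 1)
  simpa [pr] using this

lemma pr_true_sum (P : Ω → ℝ) (Z : Ω → B) :
    ∑ b, pr P (fun x => Z x = b) = ∑ x, P x := by
  have := pr_sum P (fun _ => True) Z
  simp only [true_and] at this
  rw [this]; simp [pr]

/-- Expected sum of squares of conditional probabilities. -/
def psi (P : Ω → ℝ) (Z : Ω → B) (Y : Ω → A) : ℝ :=
  ∑ s, ∑ a, pr P (fun x => Z x = s ∧ Y x = a) ^ 2 / pr P (fun x => Z x = s)

lemma psi_nonneg {P : Ω → ℝ} (hP : ∀ x, 0 ≤ P x) (Z : Ω → B) (Y : Ω → A) : 0 ≤ psi P Z Y :=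
  Finset.sum_nonneg fun s _ => Finset.sum_nonneg fun a _ =>
    div_nonneg (sq_nonneg _) (pr_nonneg hP _)

lemma psi_le_one {P : Ω → ℝ} (hP : ∀ x, 0 ≤ P x) (h1 : ∑ x, P x = 1) (Z : Ω → B) (Y : Ω → A) :
    psi P Z Y ≤ 1 := by
  have : psi P Z Y ≤ ∑ s, ∑ a, pr P (fun x => Z x = s ∧ Y x = a) := by
    refine Finset.sum_le_sum fun s _ => Finset.sum_le_sum fun a _ => ?_
    have h0 := pr_nonneg hP (fun x => Z x = s ∧ Y x = a)
    have hle : pr P (fun x => Z x = s ∧ Y x = a) ≤ pr P (fun x => Z x = s) :=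
      pr_mono hP fun x h => h.1
    refine div_le_of_le_mul₀ (h0.trans hle) h0 ?_
    rw [sq]; exact mul_le_mul_of_nonneg_left hle h0
  refine this.trans ?_
  simp only [pr_sum]
  rw [pr_true_sum, h1]

lemma psi_equiv (P : Ω → ℝ) (e : B ≃ B') (Z : Ω → B) (Y : Ω → A) :
    psi P (fun x => e (Z x)) Y = psi P Z Y := by
  unfold psi
  rw [← Equiv.sum_comp e]
  simp

/-- The scalar inequality behind the pinning step. -/
lemma pin_scalar (c d : B → ℝ) (hd : ∀ b, 0 ≤ d b) (hc0 : ∀ b, 0 ≤ c b) (hc : ∀ b, c b ≤ d b) :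
    (∑ b, d b) * ∑ b, (c b / (∑ b, d b) - d b / (∑ b, d b) * ((∑ b, c b) / ∑ b, d b)) ^ 2
      ≤ (∑ b, c b ^ 2 / d b) - (∑ b, c b) ^ 2 / ∑ b, d b := by
  set D := ∑ b, d b with hD
  set S := ∑ b, c b with hS
  have hD0 : 0 ≤ D := Finset.sum_nonneg fun b _ => hd b
  rcases hD0.eq_or_lt with h | hpos
  · rw [← h]; simp
    exact Finset.sum_nonneg fun b _ => div_nonneg (sq_nonneg _) (hd b)
  have key : ∀ b, D * (c b / D - d b / D * (S / D)) ^ 2 ≤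
      c b ^ 2 / d b - 2 * c b * (S / D) + d b * (S / D) ^ 2 := by
    intro b
    rcases (hd b).eq_or_lt with h | hb
    · have : c b = 0 := le_antisymm (h ▸ hc b) (hc0 b)
      simp [this, ← h]
    · have hle : d b ≤ D := Finset.single_le_sum (f := d) (fun b _ => hd b) (Finset.mem_univ b)
      have e1 : D * (c b / D - d b / D * (S / D)) ^ 2 = (c b - d b * (S / D)) ^ 2 / D := by
        field_simp
      have e2 : c b ^ 2 / d b - 2 * c b * (S / D) + d b * (S / D) ^ 2
          = (c b - d b * (S / D)) ^ 2 / d b := by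
        field_simp; ring
      rw [e1, e2]
      exact div_le_div_of_nonneg_left (sq_nonneg _) hb hle
  rw [Finset.mul_sum]
  refine (Finset.sum_le_sum fun b _ => key b).trans (le_of_eq ?_)
  rw [Finset.sum_add_distrib, Finset.sum_sub_distrib, ← Finset.sum_mul, ← Finset.sum_mul,
    ← Finset.mul_sum, ← hD, ← hS]
  field_simp; ring

lemma psi_pin {P : Ω → ℝ} (hP : ∀ x, 0 ≤ P x) (Z : Ω → B) (W : Ω → B') (Y : Ω → A) :
    ∑ s, pr P (fun x => Z x = s) * ∑ b, ∑ a,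
      (pr P (fun x => Z x = s ∧ Y x = a ∧ W x = b) / pr P (fun x => Z x = s)
        - pr P (fun x => Z x = s ∧ W x = b) / pr P (fun x => Z x = s)
          * (pr P (fun x => Z x = s ∧ Y x = a) / pr P (fun x => Z x = s))) ^ 2
      ≤ psi P (fun x => (Z x, W x)) Y - psi P Z Y := by
  unfold psi
  rw [Fintype.sum_prod_type, ← Finset.sum_sub_distrib]
  refine Finset.sum_le_sum fun s _ => ?_
  rw [Finset.sum_comm, Finset.mul_sum]
  rw [Finset.sum_comm (s := (Finset.univ : Finset B')), ← Finset.sum_sub_distrib]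
  refine Finset.sum_le_sum fun a _ => ?_
  have h := pin_scalar (fun b => pr P (fun x => Z x = s ∧ Y x = a ∧ W x = b))
    (fun b => pr P (fun x => Z x = s ∧ W x = b)) (fun b => pr_nonneg hP _)
    (fun b => pr_nonneg hP _) (fun b => pr_mono hP fun x h => ⟨h.1, h.2.2⟩)
  have e1 : ∑ b, pr P (fun x => Z x = s ∧ W x = b) = pr P (fun x => Z x = s) := pr_sum P _ W
  have e2 : ∑ b, pr P (fun x => Z x = s ∧ Y x = a ∧ W x = b)
      = pr P (fun x => Z x = s ∧ Y x = a) := by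
    rw [← pr_sum P (fun x => Z x = s ∧ Y x = a) W]
    exact Finset.sum_congr rfl fun b _ => pr_congr P fun x => by tauto
  simp only [e1, e2] at h
  refine h.trans (le_of_eq ?_)
  congr 1
  refine Finset.sum_congr rfl fun b _ => ?_
  congr 1
  · congr 1
    exact pr_congr P fun x => by simp only [Prod.mk.injEq]; tauto
  · exact pr_congr P fun x => by simp only [Prod.mk.injEq]

/-- Conditional deviation from independence. -/
def del {n k : ℕ} (P : (Fin n → A) → ℝ) (Z : (Fin n → A) → B) (w : Fin k → Fin n) (s : B)
    (y : Fin k → A) : ℝ :=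
  pr P (fun x => Z x = s ∧ x ∘ w = y) / pr P (fun x => Z x = s)
    - ∏ i, pr P (fun x => Z x = s ∧ x (w i) = y i) / pr P (fun x => Z x = s)

/-- Expected squared deviation. -/
def dev {n k : ℕ} (P : (Fin n → A) → ℝ) (Z : (Fin n → A) → B) (w : Fin k → Fin n) : ℝ :=
  by classical exact ∑ s, pr P (fun x => Z x = s) * ∑ y, del P Z w s y ^ 2

lemma dev_zero {n : ℕ} (P : (Fin n → A) → ℝ) (Z : (Fin n → A) → B) (w : Fin 0 → Fin n) :
    dev P Z w = 0 := by
  unfold dev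
  refine Finset.sum_eq_zero fun s _ => ?_
  by_cases h : pr P (fun x => Z x = s) = 0
  · simp [h]
  · have : ∀ y, del P Z w s y = 0 := by
      intro y
      unfold del
      have : pr P (fun x => Z x = s ∧ x ∘ w = y) = pr P (fun x => Z x = s) :=
        pr_congr P fun x => ⟨fun h => h.1, fun h => ⟨h, Subsingleton.elim _ _⟩⟩
      rw [this, div_self h]; simp
    simp [this]

lemma dev_succ {n k : ℕ} {P : (Fin n → A) → ℝ} (hP : ∀ x, 0 ≤ P x) (Z : (Fin n → A) → B)
    (u : Fin n) (w : Fin k → Fin n) :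
    dev P Z (Fin.cons u w : Fin (k+1) → Fin n) ≤
      2 * (psi P (fun x => (Z x, x ∘ w)) (fun x => x u) - psi P Z (fun x => x u))
        + 2 * dev P Z w := by
  classical
  refine le_trans ?_ (add_le_add_left (mul_le_mul_of_nonneg_left
    (psi_pin hP Z (fun x => x ∘ w) (fun x => x u)) (by norm_num : (0:ℝ) ≤ 2)) _)
  unfold dev
  rw [Finset.mul_sum, Finset.mul_sum, ← Finset.sum_add_distrib]
  refine Finset.sum_le_sum fun s _ => ?_
  set p := pr P (fun x => Z x = s) with hp
  have hp0 : 0 ≤ p := pr_nonneg hP _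
  rw [← mul_assoc, ← mul_assoc, mul_comm 2 p, mul_assoc, mul_assoc, ← mul_add]
  refine mul_le_mul_of_nonneg_left ?_ hp0
  rw [← (Fin.consEquiv (fun _ : Fin (k+1) => A)).sum_comp, Fintype.sum_prod_type]
  have step : ∀ (a : A) (y : Fin k → A),
      del P Z (Fin.cons u w : Fin (k+1) → Fin n) s (Fin.cons a y : Fin (k+1) → A) ^ 2 ≤
      2 * (pr P (fun x => Z x = s ∧ x u = a ∧ x ∘ w = y) / p
        - pr P (fun x => Z x = s ∧ x ∘ w = y) / p
          * (pr P (fun x => Z x = s ∧ x u = a) / p)) ^ 2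
      + (pr P (fun x => Z x = s ∧ x u = a) / p) * (2 * del P Z w s y ^ 2) := by
    intro a y
    have e1 : pr P (fun x => Z x = s ∧ x ∘ (Fin.cons u w : Fin (k+1) → Fin n)
        = (Fin.cons a y : Fin (k+1) → A)) = pr P (fun x => Z x = s ∧ x u = a ∧ x ∘ w = y) := by
      refine pr_congr P fun x => ?_
      rw [Fin.comp_cons, Fin.cons_inj]
    unfold del
    rw [e1, Fin.prod_univ_succ]
    simp only [Fin.cons_zero, Fin.cons_succ]
    rw [← hp]
    set q := pr P (fun x => Z x = s ∧ x u = a) / p with hq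
    set r := pr P (fun x => Z x = s ∧ x ∘ w = y) / p
    set t := pr P (fun x => Z x = s ∧ x u = a ∧ x ∘ w = y) / p
    set π := ∏ i, pr P (fun x => Z x = s ∧ x (w i) = y i) / p
    have hq0 : 0 ≤ q := div_nonneg (pr_nonneg hP _) hp0
    have hq1 : q ≤ 1 := div_le_one_of_le₀ (pr_mono hP fun x h => h.1) hp0
    have h1 : (t - q * π) = (t - r * q) + q * (r - π) := by ring
    rw [h1]
    have h2 : (q * (r - π)) ^ 2 ≤ q * (r - π) ^ 2 := by
      rw [mul_pow]
      exact mul_le_mul_of_nonneg_right (by nlinarith) (sq_nonneg _)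
    nlinarith [sq_nonneg ((t - r * q) - q * (r - π))]
  refine (Finset.sum_le_sum fun a _ => Finset.sum_le_sum fun y _ => step a y).trans ?_
  simp only [Finset.sum_add_distrib, ← Finset.mul_sum, ← Finset.sum_mul]
  refine add_le_add ?_ ?_
  · rw [Finset.sum_comm]
  · have hq : (∑ a, pr P (fun x => Z x = s ∧ x u = a) / p) ≤ 1 := by
      rw [← Finset.sum_div, pr_sum]
      exact div_le_one_of_le₀ le_rfl hp0
    have h0 : 0 ≤ 2 * ∑ y, del P Z w s y ^ 2 :=
      mul_nonneg (by norm_num) (Finset.sum_nonneg fun _ _ => sq_nonneg _)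
    calc _ ≤ 1 * (2 * ∑ y, del P Z w s y ^ 2) := mul_le_mul_of_nonneg_right hq h0
      _ = _ := one_mul _

/-- Averaged potential. -/
def phi {n : ℕ} (P : (Fin n → A) → ℝ) (m : ℕ) : ℝ :=
  by classical exact
    ((n : ℝ) ^ (m + 1))⁻¹ * ∑ v : Fin m → Fin n, ∑ u, psi P (fun x => x ∘ v) (fun x => x u)

/-- Averaged deviation. -/
def avgDev {n : ℕ} (P : (Fin n → A) → ℝ) (k m : ℕ) : ℝ :=
  by classical exact
    ((n : ℝ) ^ (m + k))⁻¹ * ∑ v : Fin m → Fin n, ∑ w : Fin k → Fin n, dev P (fun x => x ∘ v) w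

lemma phi_nonneg {n : ℕ} {P : (Fin n → A) → ℝ} (hP : ∀ x, 0 ≤ P x) (m : ℕ) : 0 ≤ phi P m := by
  unfold phi
  exact mul_nonneg (by positivity) (Finset.sum_nonneg fun v _ => Finset.sum_nonneg fun u _ =>
    psi_nonneg hP _ _)

lemma phi_le_one {n : ℕ} {P : (Fin n → A) → ℝ} (hP : ∀ x, 0 ≤ P x) (h1 : ∑ x, P x = 1) (m : ℕ) :
    phi P m ≤ 1 := by
  classical
  unfold phi
  rw [inv_mul_eq_div]
  refine div_le_one_of_le₀ ?_ (by positivity)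
  refine (Finset.sum_le_sum fun v _ => Finset.sum_le_sum fun u _ => psi_le_one hP h1 _ _).trans ?_
  simp [pow_succ]

lemma sum_phi_diff {n : ℕ} {P : (Fin n → A) → ℝ} (hP : ∀ x, 0 ≤ P x) (h1 : ∑ x, P x = 1)
    (L k : ℕ) : ∑ m ∈ Finset.range L, (phi P (m + k) - phi P m) ≤ k := by
  induction k with
  | zero => simp
  | succ k ih =>
    have : ∀ m, phi P (m + (k + 1)) - phi P m =
        (phi P ((m + 1) + k) - phi P (m + k)) + (phi P (m + k) - phi P m) := by
      intro m
      rw [show m + (k+1) = m + 1 + k by ring]; ring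
    simp only [this]
    rw [Finset.sum_add_distrib, Finset.sum_range_sub (fun m => phi P (m + k))]
    have a := phi_le_one hP h1 (L + k)
    have b := phi_nonneg hP (0 + k)
    push_cast
    linarith

lemma avgDev_succ {n : ℕ} {P : (Fin n → A) → ℝ} (hn : 0 < n) (hP : ∀ x, 0 ≤ P x) (k m : ℕ) :
    avgDev P (k+1) m ≤ 2 * (phi P (m + k) - phi P m) + 2 * avgDev P k m := by
  classical
  have hn' : (n : ℝ) ≠ 0 := by positivity
  have e1 : phi P (m + k) = ((n : ℝ) ^ (m + k + 1))⁻¹ * ∑ v : Fin m → Fin n,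
      ∑ u : Fin n, ∑ w : Fin k → Fin n,
        psi P (fun x => (x ∘ v, x ∘ w)) (fun x => x u) := by
    unfold phi
    congr 1
    rw [← (Fin.appendEquiv (α := Fin n) m k).sum_comp, Fintype.sum_prod_type]
    refine Finset.sum_congr rfl fun v _ => ?_
    rw [Finset.sum_comm]
    refine Finset.sum_congr rfl fun u _ => Finset.sum_congr rfl fun w _ => ?_
    rw [← psi_equiv P (Fin.appendEquiv (α := A) m k)]
    congr 1
    funext x
    funext i
    refine Fin.addCases (fun i => ?_) (fun i => ?_) i <;> simp [Fin.appendEquiv]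
  have e2 : phi P m = ((n : ℝ) ^ (m + k + 1))⁻¹ * ∑ v : Fin m → Fin n,
      ∑ u : Fin n, ∑ w : Fin k → Fin n, psi P (fun x => x ∘ v) (fun x => x u) := by
    unfold phi
    simp only [Finset.sum_const, Finset.card_univ, Fintype.card_pi, Fintype.card_fin,
      Finset.prod_const, nsmul_eq_mul, ← Finset.mul_sum]
    push_cast
    rw [← mul_assoc]
    congr 1
    field_simp
    try ring
  have e3 : avgDev P k m = ((n : ℝ) ^ (m + k + 1))⁻¹ * ∑ v : Fin m → Fin n,
      ∑ u : Fin n, ∑ w : Fin k → Fin n, dev P (fun x => x ∘ v) w := by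
    unfold avgDev
    simp only [Finset.sum_const, Finset.card_univ, Fintype.card_fin,
      nsmul_eq_mul, ← Finset.mul_sum]
    rw [← mul_assoc]
    congr 1
    field_simp
    try ring
  rw [e1, e2, e3]
  unfold avgDev
  rw [← mul_sub, mul_left_comm, mul_left_comm 2, ← mul_add, ← add_assoc]
  refine mul_le_mul_of_nonneg_left ?_ (by positivity)
  simp only [← Finset.sum_sub_distrib, Finset.mul_sum, ← Finset.sum_add_distrib]
  refine Finset.sum_le_sum fun v _ => ?_
  rw [← (Fin.consEquiv (fun _ : Fin (k+1) => Fin n)).sum_comp, Fintype.sum_prod_type]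
  refine Finset.sum_le_sum fun u _ => Finset.sum_le_sum fun w _ => ?_
  exact dev_succ hP _ u w

lemma avgDev_zero {n : ℕ} (P : (Fin n → A) → ℝ) (m : ℕ) : avgDev P 0 m = 0 := by
  unfold avgDev
  simp [dev_zero]

lemma sum_avgDev {n : ℕ} {P : (Fin n → A) → ℝ} (hn : 0 < n) (hP : ∀ x, 0 ≤ P x)
    (h1 : ∑ x, P x = 1) (L k : ℕ) :
    ∑ m ∈ Finset.range L, avgDev P k m ≤ 4 ^ k * k := by
  induction k with
  | zero => simp [avgDev_zero]
  | succ k ih =>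
    refine (Finset.sum_le_sum fun m _ => avgDev_succ hn hP k m).trans ?_
    rw [Finset.sum_add_distrib, ← Finset.mul_sum, ← Finset.mul_sum]
    have := sum_phi_diff hP h1 L k
    have h4 : (1:ℝ) ≤ 4 ^ k := one_le_pow₀ (by norm_num)
    have hk : (0:ℝ) ≤ k := by positivity
    rw [pow_succ]; push_cast
    nlinarith [mul_nonneg (sub_nonneg.2 h4) hk]

end Classical

section Quantum

open Matrix

lemma prodState_mul {n d : ℕ} (σ τ : Fin n → Matrix (Fin d) (Fin d) ℂ) :
    prodState σ * prodState τ = prodState (fun u => σ u * τ u) := by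
  ext x y
  simp only [prodState, Matrix.mul_apply]
  rw [Fintype.prod_sum]
  simp only [Finset.prod_mul_distrib]

lemma prodState_conjTranspose {n d : ℕ} (σ : Fin n → Matrix (Fin d) (Fin d) ℂ) :
    (prodState σ)ᴴ = prodState (fun u => (σ u)ᴴ) := by
  ext x y
  simp only [prodState, Matrix.conjTranspose_apply, star_prod]

lemma trace_prodState {n d : ℕ} (σ : Fin n → Matrix (Fin d) (Fin d) ℂ) :
    (prodState σ).trace = ∏ u, (σ u).trace := by
  simp only [prodState, Matrix.trace, Matrix.diag]
  rw [Fintype.prod_sum]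

lemma prodState_sum {n d : ℕ} {A : Type*} (t : Fin n → Finset A)
    (f : Fin n → A → Matrix (Fin d) (Fin d) ℂ) :
    prodState (fun u => ∑ b ∈ t u, f u b) =
      ∑ x ∈ Fintype.piFinset t, prodState (fun u => f u (x u)) := by
  ext p q
  simp only [prodState, Matrix.sum_apply]
  rw [Finset.prod_univ_sum]

open scoped MatrixOrder in
lemma psd_factor {m : Type*} [Fintype m] {X : Matrix m m ℂ} (hX : X.PosSemidef) :
    ∃ Y : Matrix m m ℂ, X = Yᴴ * Y := by
  classical
  obtain ⟨a, ha⟩ := CStarAlgebra.nonneg_iff_eq_star_mul_self.mp hX.nonneg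
  exact ⟨a, ha⟩

lemma prodState_psd {n d : ℕ} {σ : Fin n → Matrix (Fin d) (Fin d) ℂ}
    (h : ∀ u, (σ u).PosSemidef) : (prodState σ).PosSemidef := by
  choose Y hY using fun u => psd_factor (h u)
  have : prodState σ = (prodState Y)ᴴ * prodState Y := by
    rw [prodState_conjTranspose, prodState_mul]
    congr 1
    funext u
    exact hY u
  rw [this]
  exact Matrix.posSemidef_conjTranspose_mul_self _

lemma prodState_density {n d : ℕ} {σ : Fin n → Matrix (Fin d) (Fin d) ℂ}
    (h : ∀ u, IsDensity (σ u)) : IsDensity (prodState σ) :=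
  ⟨prodState_psd fun u => (h u).1, by
    rw [trace_prodState]; exact Finset.prod_eq_one fun u _ => (h u).2⟩

lemma trace_mul_nonneg' {m : Type*} [Fintype m] {X K : Matrix m m ℂ}
    (hX : X.PosSemidef) (hK : K.PosSemidef) : 0 ≤ (X * K).trace := by
  obtain ⟨Y, rfl⟩ := psd_factor hK
  rw [← Matrix.mul_assoc, Matrix.trace_mul_comm, ← Matrix.mul_assoc]
  exact (hX.mul_mul_conjTranspose_same Y).trace_nonneg

/-- An informationally complete measurement with dual frame. -/
structure Frame (d : ℕ) (A : Type) [Fintype A] where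
  M : A → Matrix (Fin d) (Fin d) ℂ
  D : A → Matrix (Fin d) (Fin d) ℂ
  psd : ∀ a, (M a).PosSemidef
  sumM : ∑ a, M a = 1
  trD : ∀ a, (D a).trace = 1
  dual : ∀ i j p q, ∑ a, M a q p * D a i j = if i = p ∧ j = q then 1 else 0

/-- The vectors `e_i + I^s e_j`. -/
def fvec {d : ℕ} (a : Fin d × Fin d × Fin 4) : Fin d → ℂ :=
  fun q => (if q = a.1 then 1 else 0) + Complex.I ^ (a.2.2 : ℕ) * (if q = a.2.1 then 1 else 0)

lemma fvec_mul {d : ℕ} (i j p q : Fin d) (s : Fin 4) :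
    fvec (i, j, s) q * star (fvec (i, j, s) p) =
      ((if q = i then 1 else 0) + Complex.I ^ (s : ℕ) * (if q = j then 1 else 0)) *
      ((if p = i then 1 else 0) + (-Complex.I) ^ (s : ℕ) * (if p = j then 1 else 0)) := by
  simp only [fvec, star_add, star_mul', star_pow]
  congr 2
  · split_ifs <;> simp
  · congr 1
    · simp
    · split_ifs <;> simp

lemma I_pow_three' : Complex.I ^ 3 = - Complex.I := by rw [pow_succ, Complex.I_sq]; ring

lemma I_pow_four' : Complex.I ^ 4 = 1 := by
  rw [show 4 = 2 * 2 by norm_num, pow_mul, Complex.I_sq]; norm_num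

lemma fvec_sum {d : ℕ} (i j p q : Fin d) :
    ∑ s : Fin 4, fvec (i, j, s) q * star (fvec (i, j, s) p) =
      4 * ((if q = i ∧ p = i then 1 else 0) + (if q = j ∧ p = j then 1 else 0)) := by
  simp only [fvec_mul, Fin.sum_univ_four, ite_and]
  generalize hb : (if q = j then (1:ℂ) else 0) = b
  generalize hb' : (if p = j then (1:ℂ) else 0) = b'
  generalize ha' : (if p = i then (1:ℂ) else 0) = a'
  have e1 : (if q = i then a' else 0) = (if q = i then (1:ℂ) else 0) * a' := by
    split_ifs <;> simp
  have e2 : (if q = j then b' else 0) = b * b' := by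
    rw [← hb]; split_ifs <;> simp
  rw [e1, e2]
  generalize (if q = i then (1:ℂ) else 0) = a
  have : ((3 : Fin 4) : ℕ) = 3 := rfl
  simp only [Fin.val_zero, Fin.val_one, Fin.val_two, this, pow_zero, pow_one, Complex.I_sq,
    neg_sq, I_pow_three', Odd.neg_pow (by decide : Odd 3)]
  ring_nf
  simp only [Complex.I_sq]
  ring

lemma fvec_sum_I {d : ℕ} (i j p q : Fin d) :
    ∑ s : Fin 4, (fvec (i, j, s) q * star (fvec (i, j, s) p)) * Complex.I ^ (s : ℕ) =
      4 * (if q = i ∧ p = j then 1 else 0) := by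
  simp only [fvec_mul, Fin.sum_univ_four, ite_and]
  generalize hb : (if q = j then (1:ℂ) else 0) = b
  generalize hb' : (if p = j then (1:ℂ) else 0) = b'
  generalize ha' : (if p = i then (1:ℂ) else 0) = a'
  have e1 : (if q = i then b' else 0) = (if q = i then (1:ℂ) else 0) * b' := by
    split_ifs <;> simp
  rw [e1]
  generalize (if q = i then (1:ℂ) else 0) = a
  have : ((3 : Fin 4) : ℕ) = 3 := rfl
  simp only [Fin.val_zero, Fin.val_one, Fin.val_two, this, pow_zero, pow_one, Complex.I_sq,
    neg_sq, I_pow_three', Odd.neg_pow (by decide : Odd 3)]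
  ring_nf
  simp only [Complex.I_sq, I_pow_three', I_pow_four']
  ring

/-- A concrete frame. -/
lemma exists_frame (d : ℕ) (hd : 0 < d) : Nonempty (Frame d (Fin d × Fin d × Fin 4)) := by
  have hd' : (d : ℂ) ≠ 0 := by exact_mod_cast hd.ne'
  have hM : ∀ q p, ∑ a : Fin d × Fin d × Fin 4,
      ((8 * d : ℂ)⁻¹ • vecMulVec (fvec a) (star (fvec a))) q p = (1 : Matrix _ _ ℂ) q p := by
    intro q p
    simp only [Matrix.smul_apply, vecMulVec_apply, smul_eq_mul, Pi.star_apply]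
    rw [← Finset.mul_sum]
    simp only [Fintype.sum_prod_type, fvec_sum]
    simp only [← Finset.mul_sum, Finset.sum_add_distrib, ite_and, Matrix.one_apply]
    by_cases h : q = p
    · subst h
      simp
      field_simp
      norm_num
    · have : ∀ x, (if q = x then (if p = x then (1:ℂ) else 0) else 0) = 0 := by
        intro x; split_ifs with h1 h2
        · exact (h (h1.trans h2.symm)).elim
        · rfl
        · rfl
      simp [this, h]
  refine ⟨{
    M := fun a => (8 * d : ℂ)⁻¹ • vecMulVec (fvec a) (star (fvec a))
    D := fun a => (2 * d * Complex.I ^ (a.2.2 : ℕ)) • Matrix.single a.2.1 a.1 (1:ℂ) +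
      ((1 - 2 * d * Complex.I ^ (a.2.2 : ℕ) * (if a.1 = a.2.1 then 1 else 0)) * (d : ℂ)⁻¹) •
        (1 : Matrix _ _ ℂ)
    psd := ?_
    sumM := ?_
    trD := ?_
    dual := ?_ }⟩
  · intro a
    refine (posSemidef_vecMulVec_self_star _).smul ?_
    rw [show (8 * d : ℂ)⁻¹ = (((8 * d : ℝ)⁻¹ : ℝ) : ℂ) by push_cast; rfl]
    exact_mod_cast (by positivity : (0:ℝ) ≤ (8 * d : ℝ)⁻¹)
  · ext q p
    rw [Matrix.sum_apply]; exact hM q p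
  · rintro ⟨i, j, s⟩
    simp only [Matrix.trace_add, Matrix.trace_smul, Matrix.trace_one, Fintype.card_fin]
    by_cases h : i = j
    · subst h; simp [hd']
    · have : Matrix.trace (Matrix.single j i (1:ℂ)) = 0 := by
        rw [Matrix.trace_single_eq_of_ne]; exact fun h' => h h'.symm
      simp [this, h, hd']
  · intro i j p q
    have e : ∀ a : Fin d × Fin d × Fin 4,
        ((8 * d : ℂ)⁻¹ • vecMulVec (fvec a) (star (fvec a))) q p *
        ((2 * d * Complex.I ^ (a.2.2 : ℕ)) • Matrix.single a.2.1 a.1 (1:ℂ) +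
          ((1 - 2 * d * Complex.I ^ (a.2.2 : ℕ) * (if a.1 = a.2.1 then 1 else 0)) * (d : ℂ)⁻¹) •
          (1 : Matrix (Fin d) (Fin d) ℂ) : Matrix (Fin d) (Fin d) ℂ) i j =
        (4 : ℂ)⁻¹ * ((fvec a q * star (fvec a p)) * Complex.I ^ (a.2.2 : ℕ)) *
            (if a.2.1 = i ∧ a.1 = j then 1 else 0)
        + (((8 * d : ℂ)⁻¹ • vecMulVec (fvec a) (star (fvec a))) q p
           - (4 : ℂ)⁻¹ * ((fvec a q * star (fvec a p)) * Complex.I ^ (a.2.2 : ℕ)) *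
            (if a.1 = a.2.1 then 1 else 0)) * ((d : ℂ)⁻¹ * (1 : Matrix (Fin d) (Fin d) ℂ) i j) := by
      intro a
      simp only [Matrix.smul_apply, Matrix.add_apply, vecMulVec_apply, smul_eq_mul, Pi.star_apply,
        Matrix.single_apply]
      field_simp
      ring
    simp only [e]
    rw [Finset.sum_add_distrib, ← Finset.sum_mul, Finset.sum_sub_distrib, hM]
    have s1 : ∀ c : Fin d → Fin d → ℂ, ∑ a : Fin d × Fin d × Fin 4,
        (4 : ℂ)⁻¹ * ((fvec a q * star (fvec a p)) * Complex.I ^ (a.2.2 : ℕ)) * c a.1 a.2.1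
        = c q p := by
      intro c
      simp only [Fintype.sum_prod_type]
      simp only [← Finset.sum_mul, ← Finset.mul_sum, fvec_sum_I]
      simp [ite_and]
    rw [s1 (fun x y => if y = i ∧ x = j then 1 else 0), s1 (fun x y => if x = y then 1 else 0)]
    simp only [Matrix.one_apply, sub_self, zero_mul, add_zero]
    congr 1
    simp only [eq_comm]

end Quantum

section Quantum2

set_option linter.unusedSectionVars false

open Matrix

variable {n d : ℕ} {A : Type} [Fintype A] [DecidableEq A]

/-- Outcome distribution. -/
def outc (fr : Frame d A) (X : Matrix (Fin n → Fin d) (Fin n → Fin d) ℂ) (x : Fin n → A) : ℝ :=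
  ((X * prodState (fun u => fr.M (x u))).trace).re

lemma outc_nonneg (fr : Frame d A) {X : Matrix (Fin n → Fin d) (Fin n → Fin d) ℂ}
    (hX : X.PosSemidef) (x : Fin n → A) : 0 ≤ outc fr X x :=
  (Complex.le_def.1 (trace_mul_nonneg' hX (prodState_psd fun u => fr.psd (x u)))).1

lemma outc_ofReal (fr : Frame d A) {X : Matrix (Fin n → Fin d) (Fin n → Fin d) ℂ}
    (hX : X.PosSemidef) (x : Fin n → A) :
    ((outc fr X x : ℝ) : ℂ) = (X * prodState (fun u => fr.M (x u))).trace := by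
  have h := (Complex.le_def.1 (trace_mul_nonneg' hX (prodState_psd fun u => fr.psd (x u)))).2
  apply Complex.ext
  · simp [outc]
  · simpa using h

lemma prodState_one : prodState (fun _ : Fin n => (1 : Matrix (Fin d) (Fin d) ℂ)) = 1 := by
  ext x y
  simp only [prodState, Matrix.one_apply]
  by_cases h : x = y
  · simp [h]
  · obtain ⟨u, hu⟩ := Function.ne_iff.1 h
    rw [if_neg h]
    exact Finset.prod_eq_zero (Finset.mem_univ u) (by simp [hu])

/-- Probability of a cylinder event. -/
lemma outc_cyl (fr : Frame d A) (X : Matrix (Fin n → Fin d) (Fin n → Fin d) ℂ)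
    (t : Fin n → Finset A) :
    pr (outc fr X) (fun x => ∀ u, x u ∈ t u) =
      ((X * prodState (fun u => ∑ b ∈ t u, fr.M b)).trace).re := by
  classical
  unfold pr
  rw [prodState_sum, Matrix.mul_sum, Matrix.trace_sum, Complex.re_sum]
  have : Fintype.piFinset t = Finset.univ.filter (fun x : Fin n → A => ∀ u, x u ∈ t u) := by
    ext x; simp
  rw [this, Finset.sum_filter]
  refine Finset.sum_congr rfl fun x _ => ?_
  by_cases h : ∀ u, x u ∈ t u
  · rw [if_pos h, if_pos h]; rfl
  · rw [if_neg h, if_neg h]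

lemma outc_sum (fr : Frame d A) {X : Matrix (Fin n → Fin d) (Fin n → Fin d) ℂ}
    (hX : IsDensity X) : ∑ x, outc fr X x = 1 := by
  have := outc_cyl fr X (fun _ => Finset.univ)
  simp only [fr.sumM, prodState_one, Matrix.mul_one, hX.2] at this
  simpa [pr] using this

lemma recon (fr : Frame d A) (X : Matrix (Fin n → Fin d) (Fin n → Fin d) ℂ) :
    X = ∑ x : Fin n → A, (X * prodState (fun u => fr.M (x u))).trace •
      prodState (fun u => fr.D (x u)) := by
  ext i j
  rw [Matrix.sum_apply]
  simp only [Matrix.smul_apply, smul_eq_mul, Matrix.trace, Matrix.diag, Matrix.mul_apply,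
    Finset.sum_mul]
  rw [Finset.sum_comm]
  have e : ∀ p q : Fin n → Fin d, ∑ x : Fin n → A,
      X p q * prodState (fun u => fr.M (x u)) q p * prodState (fun u => fr.D (x u)) i j =
      X p q * if i = p ∧ j = q then 1 else 0 := by
    intro p q
    simp only [mul_assoc]
    rw [← Finset.mul_sum]
    congr 1
    simp only [prodState, ← Finset.prod_mul_distrib]
    rw [← Fintype.prod_sum (fun u a => fr.M a (q u) (p u) * fr.D a (i u) (j u))]
    simp only [fr.dual]
    by_cases h : i = p ∧ j = q
    · simp [h.1, h.2]
    · rw [if_neg h]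
      have : ∃ u, ¬ (i u = p u ∧ j u = q u) := by
        by_contra hc
        push Not at hc
        exact h ⟨funext fun u => (hc u).1, funext fun u => (hc u).2⟩
      obtain ⟨u, hu⟩ := this
      exact Finset.prod_eq_zero (Finset.mem_univ u) (by rw [if_neg hu])
  have e' : ∀ p : Fin n → Fin d, ∑ x : Fin n → A, ∑ q,
      X p q * prodState (fun u => fr.M (x u)) q p * prodState (fun u => fr.D (x u)) i j =
      ∑ q, X p q * if i = p ∧ j = q then 1 else 0 := by
    intro p
    rw [Finset.sum_comm]
    exact Finset.sum_congr rfl fun q _ => e p q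
  simp only [e', ite_and]
  simp

/-- Dual symbol of an observable. -/
def sym (fr : Frame d A) (h : Matrix (Fin n → Fin d) (Fin n → Fin d) ℂ) (x : Fin n → A) : ℂ :=
  (h * prodState (fun u => fr.D (x u))).trace

lemma energy_eq (fr : Frame d A) (h : Matrix (Fin n → Fin d) (Fin n → Fin d) ℂ)
    {X : Matrix (Fin n → Fin d) (Fin n → Fin d) ℂ} (hX : X.PosSemidef) :
    energy h X = ∑ x, outc fr X x * (sym fr h x).re := by
  unfold energy
  conv_lhs => rw [recon fr X]
  rw [Matrix.mul_sum, Matrix.trace_sum, Complex.re_sum]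
  refine Finset.sum_congr rfl fun x _ => ?_
  rw [← outc_ofReal fr hX, Matrix.mul_smul, Matrix.trace_smul, smul_eq_mul, Complex.re_ofReal_mul]
  rfl

lemma entry_le_opNorm {m : Type*} [Fintype m] [DecidableEq m] (h : Matrix m m ℂ) (p q : m) :
    ‖h p q‖ ≤ opNorm h := by
  have h1 := (Matrix.toEuclideanCLM (𝕜 := ℂ) h).le_opNorm (EuclideanSpace.single q 1)
  have h2 := PiLp.norm_apply_le (Matrix.toEuclideanCLM (𝕜 := ℂ) h (EuclideanSpace.single q 1)) p
  simp at h1 h2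
  exact h2.trans h1

lemma sym_formula (fr : Frame d A) (h : Matrix (Fin n → Fin d) (Fin n → Fin d) ℂ)
    (e : Finset (Fin n)) (M : Matrix ({u // u ∈ e} → Fin d) ({u // u ∈ e} → Fin d) ℂ)
    (hM : ∀ x y, h x y = (if ∀ u ∉ e, x u = y u then (1 : ℂ) else 0) *
        M (fun u => x u.1) (fun u => y u.1)) (x : Fin n → A) :
    sym fr h x = ∑ p : {u // u ∈ e} → Fin d, ∑ q : {u // u ∈ e} → Fin d,
      M p q * ∏ u : {u // u ∈ e}, fr.D (x u) (q u) (p u) := by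
  unfold sym
  simp only [Matrix.trace, Matrix.diag, Matrix.mul_apply]
  rw [← (Equiv.piEquivPiSubtypeProd (fun u => u ∈ e) (fun _ => Fin d)).symm.sum_comp,
    Fintype.sum_prod_type]
  refine Finset.sum_congr rfl fun p _ => ?_
  simp only [← (Equiv.piEquivPiSubtypeProd (fun u => u ∈ e) (fun _ => Fin d)).symm.sum_comp
    (fun q => h _ q * _), Fintype.sum_prod_type]
  rw [Finset.sum_comm]
  refine Finset.sum_congr rfl fun q _ => ?_
  have key : ∀ p' q' : {u // ¬ u ∈ e} → Fin d,
      h ((Equiv.piEquivPiSubtypeProd (fun u => u ∈ e) (fun _ => Fin d)).symm (p, p'))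
        ((Equiv.piEquivPiSubtypeProd (fun u => u ∈ e) (fun _ => Fin d)).symm (q, q')) *
      prodState (fun u => fr.D (x u))
        ((Equiv.piEquivPiSubtypeProd (fun u => u ∈ e) (fun _ => Fin d)).symm (q, q'))
        ((Equiv.piEquivPiSubtypeProd (fun u => u ∈ e) (fun _ => Fin d)).symm (p, p')) =
      (M p q * ∏ u : {u // u ∈ e}, fr.D (x u) (q u) (p u)) *
        ((if p' = q' then 1 else 0) * ∏ u : {u // ¬ u ∈ e}, fr.D (x u) (q' u) (p' u)) := by
    intro p' q'
    rw [hM]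
    have c1 : (∀ u ∉ e, (Equiv.piEquivPiSubtypeProd (fun u => u ∈ e) (fun _ => Fin d)).symm (p, p') u
        = (Equiv.piEquivPiSubtypeProd (fun u => u ∈ e) (fun _ => Fin d)).symm (q, q') u) ↔
        p' = q' := by
      constructor
      · intro hh
        funext u
        have := hh u.1 u.2
        simpa [Equiv.piEquivPiSubtypeProd, u.2] using this
      · rintro rfl u hu
        simp [Equiv.piEquivPiSubtypeProd, hu]
    have c2 : prodState (fun u => fr.D (x u))
        ((Equiv.piEquivPiSubtypeProd (fun u => u ∈ e) (fun _ => Fin d)).symm (q, q'))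
        ((Equiv.piEquivPiSubtypeProd (fun u => u ∈ e) (fun _ => Fin d)).symm (p, p')) =
        (∏ u : {u // u ∈ e}, fr.D (x u) (q u) (p u)) *
        ∏ u : {u // ¬ u ∈ e}, fr.D (x u) (q' u) (p' u) := by
      unfold prodState
      rw [← Fintype.prod_subtype_mul_prod_subtype (fun u => u ∈ e)]
      congr 1
      · refine Finset.prod_congr (by ext; simp) fun u _ => ?_
        simp [Equiv.piEquivPiSubtypeProd, u.2]
      · refine Finset.prod_congr (by ext; simp) fun u _ => ?_
        simp [Equiv.piEquivPiSubtypeProd, u.2]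
    rw [c2]
    simp only [c1]
    have c3 : (fun u : {u // u ∈ e} =>
      (Equiv.piEquivPiSubtypeProd (fun u => u ∈ e) (fun _ => Fin d)).symm (p, p') u.1) = p := by
      funext u; simp [Equiv.piEquivPiSubtypeProd, u.2]
    have c4 : (fun u : {u // u ∈ e} =>
      (Equiv.piEquivPiSubtypeProd (fun u => u ∈ e) (fun _ => Fin d)).symm (q, q') u.1) = q := by
      funext u; simp [Equiv.piEquivPiSubtypeProd, u.2]
    rw [c3, c4]
    ring
  simp only [key, ← Finset.mul_sum]
  have tr1 : ∑ p' : {u // ¬ u ∈ e} → Fin d, ∑ q' : {u // ¬ u ∈ e} → Fin d,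
      ((if p' = q' then (1:ℂ) else 0) * ∏ u : {u // ¬ u ∈ e}, fr.D (x u) (q' u) (p' u)) = 1 := by
    simp only [ite_mul, one_mul, zero_mul, Finset.sum_ite_eq, Finset.mem_univ, if_true]
    rw [← Fintype.prod_sum (fun (u : {u // ¬ u ∈ e}) (i : Fin d) => fr.D (x u) i i)]
    refine Finset.prod_eq_one fun u _ => ?_
    exact fr.trD _
  rw [tr1, mul_one]

lemma sym_local (fr : Frame d A) {h : Matrix (Fin n → Fin d) (Fin n → Fin d) ℂ}
    {e : Finset (Fin n)} (he : ActsOn h e) {x x' : Fin n → A} (hx : ∀ u ∈ e, x u = x' u) :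
    sym fr h x = sym fr h x' := by
  obtain ⟨M, hM⟩ := he
  rw [sym_formula fr h e M hM, sym_formula fr h e M hM]
  refine Finset.sum_congr rfl fun p _ => Finset.sum_congr rfl fun q _ => ?_
  congr 1
  exact Finset.prod_congr rfl fun u _ => by rw [hx u.1 u.2]

lemma sym_bound (fr : Frame d A) (hd : 0 < d) {K : ℝ} (hK : ∀ a i j, ‖fr.D a i j‖ ≤ K)
    {h : Matrix (Fin n → Fin d) (Fin n → Fin d) ℂ}
    {e : Finset (Fin n)} {k : ℕ} (hk : e.card = k) (he : ActsOn h e) (x : Fin n → A) :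
    |(sym fr h x).re| ≤ ((d : ℝ) ^ k * d ^ k * K ^ k) * opNorm h := by
  refine (Complex.abs_re_le_norm _).trans ?_
  obtain ⟨M, hM⟩ := he
  rw [sym_formula fr h e M hM]
  have hMb : ∀ p q, ‖M p q‖ ≤ opNorm h := by
    intro p q
    let z : Fin d := ⟨0, hd⟩
    have := hM (fun u => if hu : u ∈ e then p ⟨u, hu⟩ else z)
      (fun u => if hu : u ∈ e then q ⟨u, hu⟩ else z)
    rw [if_pos (by intro u hu; simp [hu]), one_mul] at this
    have h2 : M p q = h (fun u => if hu : u ∈ e then p ⟨u, hu⟩ else z)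
      (fun u => if hu : u ∈ e then q ⟨u, hu⟩ else z) := by
      rw [this]; simp
    rw [h2]
    exact entry_le_opNorm _ _ _
  have h0 : 0 ≤ opNorm h := norm_nonneg _
  have hterm : ∀ p q, ‖M p q * ∏ u : {u // u ∈ e}, fr.D (x u) (q u) (p u)‖ ≤ opNorm h * K ^ k := by
    intro p q
    rw [norm_mul]
    refine mul_le_mul (hMb p q) ?_ (norm_nonneg _) h0
    rw [norm_prod]
    refine (Finset.prod_le_prod (fun u _ => norm_nonneg _) (fun u _ => hK _ _ _)).trans ?_
    simp [hk]
  refine (norm_sum_le _ _).trans ((Finset.sum_le_sum fun p _ => (norm_sum_le _ _).trans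
    (Finset.sum_le_sum fun q _ => hterm p q)).trans (le_of_eq ?_))
  simp [hk]
  ring

lemma prodState_update_apply (N : Fin n → Matrix (Fin d) (Fin d) ℂ) (u : Fin n)
    (Y : Matrix (Fin d) (Fin d) ℂ) (x y : Fin n → Fin d) :
    prodState (Function.update N u Y) x y =
      Y (x u) (y u) * ∏ w ∈ Finset.univ.erase u, N w (x w) (y w) := by
  unfold prodState
  rw [← Finset.mul_prod_erase _ _ (Finset.mem_univ u)]
  simp only [Function.update_self]
  congr 1
  refine Finset.prod_congr rfl fun w hw => ?_
  rw [Function.update_of_ne (Finset.ne_of_mem_erase hw)]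

/-- Reduced operator at `u` after applying the effects `N` elsewhere. -/
def red (ρ : Matrix (Fin n → Fin d) (Fin n → Fin d) ℂ) (N : Fin n → Matrix (Fin d) (Fin d) ℂ)
    (u : Fin n) : Matrix (Fin d) (Fin d) ℂ :=
  fun i j => (ρ * prodState (Function.update N u (Matrix.single j i 1))).trace

lemma trace_red_mul (ρ : Matrix (Fin n → Fin d) (Fin n → Fin d) ℂ)
    (N : Fin n → Matrix (Fin d) (Fin d) ℂ) (u : Fin n) (Y : Matrix (Fin d) (Fin d) ℂ) :
    (red ρ N u * Y).trace = (ρ * prodState (Function.update N u Y)).trace := by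
  have e : prodState (Function.update N u Y) = ∑ i, ∑ j, Y j i •
      prodState (Function.update N u (Matrix.single j i (1:ℂ))) := by
    ext x y
    simp only [Matrix.sum_apply, Matrix.smul_apply, smul_eq_mul, prodState_update_apply,
      ← mul_assoc, ← Finset.sum_mul]
    congr 1
    simp [Matrix.single_apply, ite_and]
  rw [e, Matrix.mul_sum, Matrix.trace_sum]
  simp only [Matrix.trace, Matrix.diag, Matrix.mul_apply (M := red ρ N u)]
  refine Finset.sum_congr rfl fun i _ => ?_
  have : ∀ M : Matrix (Fin n → Fin d) (Fin n → Fin d) ℂ, ∑ x, M x x = M.trace := fun _ => rfl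
  rw [this, Matrix.mul_sum, Matrix.trace_sum]
  refine Finset.sum_congr rfl fun j _ => ?_
  rw [Matrix.mul_smul, Matrix.trace_smul, smul_eq_mul, mul_comm]
  rfl

lemma red_psd {ρ : Matrix (Fin n → Fin d) (Fin n → Fin d) ℂ} (hρ : ρ.PosSemidef)
    {N : Fin n → Matrix (Fin d) (Fin d) ℂ} (hN : ∀ w, (N w).PosSemidef) (u : Fin n) :
    (red ρ N u).PosSemidef := by
  refine Matrix.PosSemidef.of_dotProduct_mulVec_nonneg ?_ fun z => ?_
  · ext i j
    rw [Matrix.conjTranspose_apply]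
    unfold red
    rw [← Matrix.trace_conjTranspose, Matrix.conjTranspose_mul, prodState_conjTranspose,
      hρ.1.eq, Matrix.trace_mul_comm]
    congr 3
    funext w
    by_cases hw : w = u
    · subst hw; simp
    · simp [Function.update_of_ne hw, (hN w).1.eq]
  · have : star z ⬝ᵥ red ρ N u *ᵥ z = (red ρ N u * vecMulVec z (star z)).trace := by
      simp only [dotProduct, mulVec, Matrix.trace, Matrix.diag, Matrix.mul_apply, vecMulVec_apply,
        Finset.mul_sum, Pi.star_apply]
      refine Finset.sum_congr rfl fun i _ => Finset.sum_congr rfl fun j _ => by ring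
    rw [this, trace_red_mul]
    refine trace_mul_nonneg' hρ (prodState_psd fun w => ?_)
    by_cases hw : w = u
    · subst hw; simpa using posSemidef_vecMulVec_self_star z
    · simpa [Function.update_of_ne hw] using hN w

end Quantum2

section Assembly

set_option linter.unusedSectionVars false

open Matrix

variable {n d : ℕ} {A : Type} [Fintype A] [DecidableEq A]

/-- Outcomes at site `u` compatible with the pinned data. -/
def cset {m : ℕ} (v : Fin m → Fin n) (s : Fin m → A) (u : Fin n) : Finset A :=
  Finset.univ.filter (fun b => ∀ i, v i = u → s i = b)

lemma cset_iff {m : ℕ} (v : Fin m → Fin n) (s : Fin m → A) (x : Fin n → A) :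
    x ∘ v = s ↔ ∀ u, x u ∈ cset v s u := by
  simp only [cset, Finset.mem_filter, Finset.mem_univ, true_and]
  constructor
  · rintro rfl u i rfl
    rfl
  · intro h
    funext i
    exact (h (v i) i rfl).symm

/-- The effect at site `u`. -/
def eff (fr : Frame d A) {m : ℕ} (v : Fin m → Fin n) (s : Fin m → A) (u : Fin n) :
    Matrix (Fin d) (Fin d) ℂ := ∑ b ∈ cset v s u, fr.M b

lemma eff_psd (fr : Frame d A) {m : ℕ} (v : Fin m → Fin n) (s : Fin m → A) (u : Fin n) :
    (eff fr v s u).PosSemidef :=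
  Matrix.posSemidef_sum _ fun b _ => fr.psd b

lemma eff_one (fr : Frame d A) {m : ℕ} (v : Fin m → Fin n) (s : Fin m → A) (u : Fin n)
    (hu : ∀ i, v i ≠ u) : eff fr v s u = 1 := by
  have : cset v s u = Finset.univ := by
    ext b; simp [cset, hu]
  rw [eff, this, fr.sumM]

lemma eff_inj (fr : Frame d A) {k : ℕ} (w : Fin k → Fin n) (hw : Function.Injective w)
    (y : Fin k → A) (i : Fin k) : eff fr w y (w i) = fr.M (y i) := by
  have : cset w y (w i) = {y i} := by
    ext b
    simp only [cset, Finset.mem_filter, Finset.mem_univ, true_and, Finset.mem_singleton]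
    constructor
    · intro h; exact (h i rfl).symm
    · rintro rfl j hj; rw [hw hj]
  rw [eff, this, Finset.sum_singleton]

lemma pr_eff (fr : Frame d A) (X : Matrix (Fin n → Fin d) (Fin n → Fin d) ℂ) {m : ℕ}
    (v : Fin m → Fin n) (s : Fin m → A) :
    pr (outc fr X) (fun x => x ∘ v = s) = ((X * prodState (eff fr v s)).trace).re := by
  rw [pr_congr _ (cset_iff v s), outc_cyl]
  rfl

lemma pr_eff_site (fr : Frame d A) (X : Matrix (Fin n → Fin d) (Fin n → Fin d) ℂ) {m : ℕ}
    (v : Fin m → Fin n) (s : Fin m → A) (u : Fin n) (hu : ∀ i, v i ≠ u) (a : A) :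
    pr (outc fr X) (fun x => x ∘ v = s ∧ x u = a) =
      ((X * prodState (Function.update (eff fr v s) u (fr.M a))).trace).re := by
  have h : ∀ x : Fin n → A, (x ∘ v = s ∧ x u = a) ↔
      ∀ w, x w ∈ Function.update (cset v s) u {a} w := by
    intro x
    rw [cset_iff]
    constructor
    · rintro ⟨h1, h2⟩ w
      by_cases hw : w = u
      · subst hw; simp [h2]
      · rw [Function.update_of_ne hw]; exact h1 w
    · intro h
      have hua : x u = a := by simpa using h u
      refine ⟨fun w => ?_, hua⟩
      by_cases hw : w = u
      · subst hw; simp [cset, hu]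
      · have := h w
        rwa [Function.update_of_ne hw] at this
  rw [pr_congr _ h, outc_cyl]
  congr 4
  funext w
  by_cases hw : w = u
  · subst hw; simp
  · simp [Function.update_of_ne hw, eff]

open Classical in
/-- Conditional one-site state. -/
def tau (fr : Frame d A) (ρ : Matrix (Fin n → Fin d) (Fin n → Fin d) ℂ) {m : ℕ}
    (v : Fin m → Fin n) (s : Fin m → A) (u : Fin n) : Matrix (Fin d) (Fin d) ℂ :=
  if (∃ i, v i = u) ∨ pr (outc fr ρ) (fun x => x ∘ v = s) = 0 then
    (((d : ℝ)⁻¹ : ℝ) : ℂ) • 1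
  else (((pr (outc fr ρ) (fun x => x ∘ v = s))⁻¹ : ℝ) : ℂ) • red ρ (eff fr v s) u

lemma tau_density (fr : Frame d A) (hd : 0 < d) {ρ : Matrix (Fin n → Fin d) (Fin n → Fin d) ℂ}
    (hρ : ρ.PosSemidef) {m : ℕ} (v : Fin m → Fin n) (s : Fin m → A) (u : Fin n) :
    IsDensity (tau fr ρ v s u) := by
  unfold tau
  split_ifs with h
  · refine ⟨Matrix.PosSemidef.one.smul (by exact_mod_cast (by positivity : (0:ℝ) ≤ (d:ℝ)⁻¹)), ?_⟩
    have : (d : ℂ) ≠ 0 := by exact_mod_cast hd.ne'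
    simp [this]
  · push Not at h
    have hp := pr_nonneg (outc_nonneg fr hρ) (fun x => x ∘ v = s)
    refine ⟨(red_psd hρ (eff_psd fr v s) u).smul (by exact_mod_cast inv_nonneg.2 hp), ?_⟩
    have e1 : (red ρ (eff fr v s) u).trace = (ρ * prodState (eff fr v s)).trace := by
      have := trace_red_mul ρ (eff fr v s) u 1
      rw [Matrix.mul_one] at this
      rw [this, ← eff_one fr v s u h.1, Function.update_eq_self]
    have e2 : ((pr (outc fr ρ) (fun x => x ∘ v = s) : ℝ) : ℂ)
        = (ρ * prodState (eff fr v s)).trace := by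
      rw [pr_eff]
      have := (Complex.le_def.1 (trace_mul_nonneg' hρ (prodState_psd (eff_psd fr v s)))).2
      apply Complex.ext
      · simp
      · simpa using this
    rw [Matrix.trace_smul, e1, ← e2, smul_eq_mul, ← Complex.ofReal_mul, inv_mul_cancel₀ h.2]
    simp

lemma tau_prob (fr : Frame d A) (ρ : Matrix (Fin n → Fin d) (Fin n → Fin d) ℂ) {m : ℕ}
    (v : Fin m → Fin n) (s : Fin m → A) (u : Fin n) (hu : ∀ i, v i ≠ u)
    (hp : pr (outc fr ρ) (fun x => x ∘ v = s) ≠ 0) (a : A) :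
    ((tau fr ρ v s u * fr.M a).trace).re =
      pr (outc fr ρ) (fun x => x ∘ v = s ∧ x u = a) / pr (outc fr ρ) (fun x => x ∘ v = s) := by
  unfold tau
  rw [if_neg (by push Not; exact ⟨hu, hp⟩), Matrix.smul_mul, Matrix.trace_smul, trace_red_mul,
    smul_eq_mul, Complex.re_ofReal_mul, ← pr_eff_site fr ρ v s u hu a]
  rw [div_eq_inv_mul]

lemma prod_marginal (fr : Frame d A) {τ : Fin n → Matrix (Fin d) (Fin d) ℂ}
    (hτ : ∀ u, IsDensity (τ u)) {k : ℕ} (w : Fin k → Fin n) (hw : Function.Injective w)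
    (y : Fin k → A) :
    pr (outc fr (prodState τ)) (fun x => x ∘ w = y) =
      ∏ i, ((τ (w i) * fr.M (y i)).trace).re := by
  rw [pr_eff, prodState_mul, trace_prodState]
  have h1 : ∏ u, (τ u * eff fr w y u).trace = ∏ i, (τ (w i) * fr.M (y i)).trace := by
    have : ∀ i, (τ (w i) * fr.M (y i)).trace = (fun u => (τ u * eff fr w y u).trace) (w i) := by
      intro i
      simp only [eff_inj fr w hw]
    simp only [this]
    rw [← Finset.prod_image (s := Finset.univ) (g := w) (f := fun u => (τ u * eff fr w y u).trace)
      (fun i _ j _ h => hw h)]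
    symm
    refine Finset.prod_subset (Finset.subset_univ _) fun u _ hu => ?_
    have hu' : ∀ i, w i ≠ u := by
      intro i hi
      exact hu (Finset.mem_image.2 ⟨i, Finset.mem_univ _, hi⟩)
    rw [eff_one fr w y u hu', Matrix.mul_one, (hτ u).2]
  have h2 : ∀ i, (τ (w i) * fr.M (y i)).trace = ((((τ (w i) * fr.M (y i)).trace).re : ℝ) : ℂ) := by
    intro i
    have := (Complex.le_def.1 (trace_mul_nonneg' (hτ (w i)).1 (fr.psd (y i)))).2
    apply Complex.ext
    · simp
    · simpa using this.symm
  rw [h1, Finset.prod_congr rfl fun i _ => h2 i, ← Complex.ofReal_prod, Complex.ofReal_re]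

/-- Local symbol. -/
def gsym (fr : Frame d A) (a0 : A) (h : Matrix (Fin n → Fin d) (Fin n → Fin d) ℂ) {k : ℕ}
    (w : Fin k → Fin n) (y : Fin k → A) : ℝ :=
  (sym fr h (Function.extend w y (fun _ => a0))).re

lemma sym_gsym (fr : Frame d A) (a0 : A) {h : Matrix (Fin n → Fin d) (Fin n → Fin d) ℂ}
    {e : Finset (Fin n)} (he : ActsOn h e) {k : ℕ}
    {w : Fin k → Fin n} (hw : Function.Injective w) (hwe : ∀ u ∈ e, ∃ i, w i = u)
    (x : Fin n → A) : (sym fr h x).re = gsym fr a0 h w (x ∘ w) := by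
  unfold gsym
  rw [sym_local fr he (x' := Function.extend w (x ∘ w) (fun _ => a0))]
  intro u hu
  obtain ⟨i, rfl⟩ := hwe u hu
  rw [hw.extend_apply]; rfl

lemma energy_marg (fr : Frame d A) (a0 : A) {h : Matrix (Fin n → Fin d) (Fin n → Fin d) ℂ}
    {e : Finset (Fin n)} (he : ActsOn h e) {k : ℕ}
    {w : Fin k → Fin n} (hw : Function.Injective w) (hwe : ∀ u ∈ e, ∃ i, w i = u)
    {X : Matrix (Fin n → Fin d) (Fin n → Fin d) ℂ} (hX : X.PosSemidef) :
    energy h X = ∑ y, pr (outc fr X) (fun x => x ∘ w = y) * gsym fr a0 h w y := by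
  rw [energy_eq fr h hX]
  have := pr_sum_mul (outc fr X) (fun _ => True) (fun x => x ∘ w) (gsym fr a0 h w)
  simp only [true_and, if_true] at this
  rw [this]
  exact Finset.sum_congr rfl fun x _ => by rw [sym_gsym fr a0 he hw hwe]

lemma energy_abs_le (fr : Frame d A) {h : Matrix (Fin n → Fin d) (Fin n → Fin d) ℂ} {c : ℝ}
    (hc : ∀ x, |(sym fr h x).re| ≤ c) {X : Matrix (Fin n → Fin d) (Fin n → Fin d) ℂ}
    (hX : IsDensity X) : |energy h X| ≤ c := by
  rw [energy_eq fr h hX.1]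
  refine (Finset.abs_sum_le_sum_abs _ _).trans ?_
  calc _ ≤ ∑ x, outc fr X x * c := by
        refine Finset.sum_le_sum fun x _ => ?_
        rw [abs_mul, abs_of_nonneg (outc_nonneg fr hX.1 x)]
        exact mul_le_mul_of_nonneg_left (hc x) (outc_nonneg fr hX.1 x)
    _ = c := by rw [← Finset.sum_mul, outc_sum fr hX, one_mul]

lemma energy_sum_smul {ι m : Type*} [Fintype m] (s : Finset ι) (h : Matrix m m ℂ) (p : ι → ℝ)
    (τ : ι → Matrix m m ℂ) :
    energy h (∑ i ∈ s, (p i : ℂ) • τ i) = ∑ i ∈ s, p i * energy h (τ i) := by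
  unfold energy
  rw [Matrix.mul_sum, Matrix.trace_sum, Complex.re_sum]
  refine Finset.sum_congr rfl fun i _ => ?_
  rw [Matrix.mul_smul, Matrix.trace_smul, smul_eq_mul, Complex.re_ofReal_mul]

lemma energy_sum_left {ι m : Type*} [Fintype m] (s : Finset ι) (h : ι → Matrix m m ℂ)
    (X : Matrix m m ℂ) : energy (∑ i ∈ s, h i) X = ∑ i ∈ s, energy (h i) X := by
  unfold energy
  rw [Matrix.sum_mul, Matrix.trace_sum, Complex.re_sum]

/-- The separable state obtained from pinning `v`. -/
def sepState (fr : Frame d A) (ρ : Matrix (Fin n → Fin d) (Fin n → Fin d) ℂ) {m : ℕ}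
    (v : Fin m → Fin n) : Matrix (Fin n → Fin d) (Fin n → Fin d) ℂ :=
  ∑ s : Fin m → A, ((pr (outc fr ρ) (fun x => x ∘ v = s) : ℝ) : ℂ) • prodState (tau fr ρ v s)

lemma pr_pin_sum (fr : Frame d A) {ρ : Matrix (Fin n → Fin d) (Fin n → Fin d) ℂ}
    (hρ : IsDensity ρ) {m : ℕ} (v : Fin m → Fin n) :
    ∑ s : Fin m → A, pr (outc fr ρ) (fun x => x ∘ v = s) = 1 := by
  rw [pr_true_sum (outc fr ρ) (fun x => x ∘ v), outc_sum fr hρ]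

lemma sepState_sep (fr : Frame d A) (hd : 0 < d) {ρ : Matrix (Fin n → Fin d) (Fin n → Fin d) ℂ}
    (hρ : IsDensity ρ) {m : ℕ} (v : Fin m → Fin n) : IsSeparable (sepState fr ρ v) := by
  let q := (Fintype.equivFin (Fin m → A)).symm
  refine ⟨Fintype.card (Fin m → A), fun i => pr (outc fr ρ) (fun x => x ∘ v = q i),
    fun i => tau fr ρ v (q i), fun i => pr_nonneg (outc_nonneg fr hρ.1) _, ?_,
    fun i u => tau_density fr hd hρ.1 v _ u, ?_⟩
  · rw [q.sum_comp (fun s => pr (outc fr ρ) (fun x => x ∘ v = s)), pr_pin_sum fr hρ]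
  · unfold sepState
    rw [← q.sum_comp]

open Classical in
lemma edge_error (fr : Frame d A) (hd : 0 < d) (a0 : A)
    {ρ : Matrix (Fin n → Fin d) (Fin n → Fin d) ℂ}
    (hρ : IsDensity ρ) {m : ℕ} (v : Fin m → Fin n)
    {h : Matrix (Fin n → Fin d) (Fin n → Fin d) ℂ}
    {e : Finset (Fin n)} (he : ActsOn h e) {k : ℕ}
    {w : Fin k → Fin n} (hw : Function.Injective w) (hwe : ∀ u, u ∈ e ↔ ∃ i, w i = u)
    {c : ℝ} (hc : ∀ x : Fin n → A, |(sym fr h x).re| ≤ c) :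
    |energy h ρ - energy h (sepState fr ρ v)| ≤
      c * (2 * (if ∃ i, v i ∈ e then 1 else 0) +
        ∑ s, pr (outc fr ρ) (fun x => x ∘ v = s) *
          ∑ y, |del (outc fr ρ) (fun x => x ∘ v) w s y|) := by
  have hc0 : 0 ≤ c := (abs_nonneg _).trans (hc fun _ => a0)
  have hp0 : ∀ s : Fin m → A, 0 ≤ pr (outc fr ρ) (fun x => x ∘ v = s) :=
    fun s => pr_nonneg (outc_nonneg fr hρ.1) _
  have hsum0 : 0 ≤ ∑ s, pr (outc fr ρ) (fun x => x ∘ v = s) *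
          ∑ y, |del (outc fr ρ) (fun x => x ∘ v) w s y| :=
    Finset.sum_nonneg fun s _ => mul_nonneg (hp0 s) (Finset.sum_nonneg fun y _ => abs_nonneg _)
  have hσ : energy h (sepState fr ρ v) = ∑ s, pr (outc fr ρ) (fun x => x ∘ v = s) *
      energy h (prodState (tau fr ρ v s)) := energy_sum_smul _ _ _ _
  have hdens : ∀ s, IsDensity (prodState (tau fr ρ v s)) := fun s =>
    prodState_density fun u => tau_density fr hd hρ.1 v s u
  by_cases hit : ∃ i, v i ∈ e
  · rw [if_pos hit]
    have h1 := energy_abs_le fr hc hρ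
    have h2 : |energy h (sepState fr ρ v)| ≤ c := by
      rw [hσ]
      refine (Finset.abs_sum_le_sum_abs _ _).trans ?_
      calc _ ≤ ∑ s, pr (outc fr ρ) (fun x => x ∘ v = s) * c := by
            refine Finset.sum_le_sum fun s _ => ?_
            rw [abs_mul, abs_of_nonneg (hp0 s)]
            exact mul_le_mul_of_nonneg_left (energy_abs_le fr hc (hdens s)) (hp0 s)
        _ = c := by rw [← Finset.sum_mul, pr_pin_sum fr hρ, one_mul]
    have h3 := abs_sub (energy h ρ) (energy h (sepState fr ρ v))
    nlinarith [mul_nonneg hc0 hsum0]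
  · rw [if_neg hit, mul_zero, zero_add]
    have hv : ∀ i j, v j ≠ w i := fun i j hji => hit ⟨j, (hwe _).2 ⟨i, hji.symm⟩⟩
    have hg : ∀ y, |gsym fr a0 h w y| ≤ c := fun y => hc _
    have e1 : energy h ρ = ∑ s, ∑ y,
        pr (outc fr ρ) (fun x => x ∘ v = s ∧ x ∘ w = y) * gsym fr a0 h w y := by
      rw [energy_marg fr a0 he hw (fun u hu => (hwe u).1 hu) hρ.1, Finset.sum_comm]
      refine Finset.sum_congr rfl fun y _ => ?_
      rw [← Finset.sum_mul, ← pr_sum (outc fr ρ) (fun x => x ∘ w = y) (fun x => x ∘ v)]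
      congr 1
      exact Finset.sum_congr rfl fun s _ => pr_congr _ fun x => and_comm
    have e2 : ∀ s, pr (outc fr ρ) (fun x => x ∘ v = s) * energy h (prodState (tau fr ρ v s)) =
        (∑ y, pr (outc fr ρ) (fun x => x ∘ v = s ∧ x ∘ w = y) * gsym fr a0 h w y) -
        pr (outc fr ρ) (fun x => x ∘ v = s) *
          ∑ y, del (outc fr ρ) (fun x => x ∘ v) w s y * gsym fr a0 h w y := by
      intro s
      by_cases hp : pr (outc fr ρ) (fun x => x ∘ v = s) = 0
      · have : ∀ y, pr (outc fr ρ) (fun x => x ∘ v = s ∧ x ∘ w = y) = 0 := fun y =>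
          le_antisymm (hp ▸ pr_mono (outc_nonneg fr hρ.1) fun x hx => hx.1)
            (pr_nonneg (outc_nonneg fr hρ.1) _)
        simp [hp, this]
      · rw [energy_marg fr a0 he hw (fun u hu => (hwe u).1 hu) (hdens s).1,
          Finset.mul_sum, Finset.mul_sum, ← Finset.sum_sub_distrib]
        refine Finset.sum_congr rfl fun y _ => ?_
        rw [prod_marginal fr (fun u => tau_density fr hd hρ.1 v s u) w hw y]
        rw [Finset.prod_congr rfl fun i _ => tau_prob fr ρ v s (w i) (hv i) hp (y i)]
        unfold del
        rw [sub_mul, mul_sub, ← mul_assoc _ (_ / _), mul_div_cancel₀ _ hp]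
        ring
    rw [hσ, e1]
    simp only [e2, Finset.sum_sub_distrib, sub_sub_cancel]
    refine (Finset.abs_sum_le_sum_abs _ _).trans ?_
    rw [Finset.mul_sum]
    refine Finset.sum_le_sum fun s _ => ?_
    rw [abs_mul, abs_of_nonneg (hp0 s), mul_left_comm]
    refine mul_le_mul_of_nonneg_left ?_ (hp0 s)
    rw [Finset.mul_sum]
    refine (Finset.abs_sum_le_sum_abs _ _).trans (Finset.sum_le_sum fun y _ => ?_)
    rw [abs_mul, mul_comm]
    exact mul_le_mul_of_nonneg_right (hg y) (abs_nonneg _)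

end Assembly

section Final

set_option linter.unusedSectionVars false

variable {n d : ℕ} {A : Type} [Fintype A] [DecidableEq A]

lemma opNorm_nonneg' {m : Type*} [Fintype m] [DecidableEq m] (h : Matrix m m ℂ) :
    0 ≤ opNorm h := norm_nonneg _

lemma sum_coord (m : ℕ) (i : Fin m) (f : Fin n → ℝ) :
    (n : ℝ) * ∑ v : Fin m → Fin n, f (v i) = (n : ℝ) ^ m * ∑ u, f u := by
  cases m with
  | zero => exact i.elim0
  | succ m =>
    rw [← (Fin.insertNthEquiv (fun _ : Fin (m + 1) => Fin n) i).sum_comp, Fintype.sum_prod_type]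
    simp only [Fin.insertNthEquiv_apply, Fin.insertNth_apply_same, Finset.sum_const,
      Finset.card_univ, Fintype.card_fun, Fintype.card_fin, nsmul_eq_mul]
    rw [← Finset.mul_sum]
    push_cast
    ring

open Classical in
lemma hit_sum (hn : 0 < n) (m : ℕ) (e : Finset (Fin n)) :
    ((n : ℝ) ^ m)⁻¹ * ∑ v : Fin m → Fin n, (if ∃ i, v i ∈ e then (1 : ℝ) else 0) ≤
      (m : ℝ) * e.card / n := by
  have hn' : (0 : ℝ) < n := by exact_mod_cast hn
  have h1 : ∑ v : Fin m → Fin n, (if ∃ i, v i ∈ e then (1 : ℝ) else 0) ≤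
      ∑ v : Fin m → Fin n, ∑ i, (if v i ∈ e then (1 : ℝ) else 0) := by
    refine Finset.sum_le_sum fun v _ => ?_
    have h0 : ∀ i ∈ (Finset.univ : Finset (Fin m)), (0 : ℝ) ≤ if v i ∈ e then (1 : ℝ) else 0 :=
      fun i _ => by split_ifs <;> norm_num
    split_ifs with hv
    · obtain ⟨i, hi⟩ := hv
      have := Finset.single_le_sum h0 (Finset.mem_univ i)
      rwa [if_pos hi] at this
    · exact Finset.sum_nonneg h0
  have h2 : (n : ℝ) * ∑ v : Fin m → Fin n, ∑ i, (if v i ∈ e then (1 : ℝ) else 0) =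
      (n : ℝ) ^ m * (m * e.card) := by
    rw [Finset.sum_comm, Finset.mul_sum]
    simp only [sum_coord m _ (fun u => if u ∈ e then (1 : ℝ) else 0)]
    simp
    ring
  rw [le_div_iff₀ hn', mul_assoc, inv_mul_le_iff₀ (by positivity), ← h2, mul_comm]
  exact mul_le_mul_of_nonneg_left h1 hn'.le

lemma pigeon (hn : 0 < n) (L : ℕ) (hL : 0 < L) (f : (m : ℕ) → (Fin m → Fin n) → ℝ) (B : ℝ)
    (h : ∑ m ∈ Finset.range L, ((n : ℝ) ^ m)⁻¹ * ∑ v : Fin m → Fin n, f m v ≤ L * B) :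
    ∃ (m : ℕ) (v : Fin m → Fin n), f m v ≤ B := by
  by_contra! hc
  have hn' : (0 : ℝ) < n := by exact_mod_cast hn
  have : Nonempty (Fin n) := ⟨⟨0, hn⟩⟩
  have : ∑ m ∈ Finset.range L, B <
      ∑ m ∈ Finset.range L, ((n : ℝ) ^ m)⁻¹ * ∑ v : Fin m → Fin n, f m v := by
    refine Finset.sum_lt_sum_of_nonempty ⟨0, by simpa using hL⟩ fun m _ => ?_
    rw [lt_inv_mul_iff₀ (by positivity)]
    calc (n : ℝ) ^ m * B = ∑ v : Fin m → Fin n, B := by simp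
      _ < _ := Finset.sum_lt_sum_of_nonempty Finset.univ_nonempty fun v _ => hc m v
  simp only [Finset.sum_const, Finset.card_range, nsmul_eq_mul] at this
  linarith

lemma dev_nonneg {B : Type*} [Fintype B] {k : ℕ} {P : (Fin n → A) → ℝ} (hP : ∀ x, 0 ≤ P x)
    (Z : (Fin n → A) → B) (w : Fin k → Fin n) : 0 ≤ dev P Z w := by
  unfold dev
  exact Finset.sum_nonneg fun s _ => mul_nonneg (pr_nonneg hP _)
    (Finset.sum_nonneg fun y _ => sq_nonneg _)

lemma exists_enum (hn : 0 < n) (k : ℕ) : ∃ we : Finset (Fin n) → (Fin k → Fin n),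
    ∀ e, e.card = k → Function.Injective (we e) ∧ ∀ u, u ∈ e ↔ ∃ i, we e i = u := by
  classical
  refine ⟨fun e => if h : e.card = k then e.orderEmbOfFin h else fun _ => ⟨0, hn⟩, ?_⟩
  intro e he
  simp only [he, dif_pos]
  refine ⟨(e.orderEmbOfFin he).injective, fun u => ?_⟩
  have := Finset.range_orderEmbOfFin e he
  rw [← Finset.mem_coe, ← this, Set.mem_range]

/-- AM-GM for the deviation term. -/
lemma amgm {k m : ℕ} {P : (Fin n → A) → ℝ} (hP : ∀ x, 0 ≤ P x) (v : Fin m → Fin n)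
    (h1 : ∑ s : Fin m → A, pr P (fun x => x ∘ v = s) = 1) (w : Fin k → Fin n) (J lam : ℝ)
    (hlam : 0 < lam) :
    J * ∑ s : Fin m → A, pr P (fun x => x ∘ v = s) *
        ∑ y, |del P (fun x => x ∘ v) w s y| ≤
      (lam * (Fintype.card A : ℝ) ^ k * J ^ 2 + lam⁻¹ * dev P (fun x => x ∘ v) w) / 2 := by
  have key : ∀ δ : ℝ, J * |δ| ≤ (lam * J ^ 2 + lam⁻¹ * δ ^ 2) / 2 := by
    intro δ
    have h2 : 0 ≤ lam⁻¹ * (lam * J - |δ|) ^ 2 := by positivity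
    have h3 : lam⁻¹ * (lam * J - |δ|) ^ 2 = lam * J ^ 2 - 2 * (J * |δ|) + lam⁻¹ * δ ^ 2 := by
      rw [← sq_abs δ]
      field_simp
      ring
    linarith
  have key2 : ∀ s : Fin m → A, J * ∑ y, |del P (fun x => x ∘ v) w s y| ≤
      (lam * (Fintype.card A : ℝ) ^ k * J ^ 2 +
        lam⁻¹ * ∑ y, del P (fun x => x ∘ v) w s y ^ 2) / 2 := by
    intro s
    rw [Finset.mul_sum]
    refine (Finset.sum_le_sum fun y _ => key _).trans (le_of_eq ?_)
    rw [← Finset.sum_div, Finset.sum_add_distrib, Finset.mul_sum _ _ lam⁻¹]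
    simp
    ring
  have : dev P (fun x => x ∘ v) w = ∑ s : Fin m → A, pr P (fun x => x ∘ v = s) *
      ∑ y, del P (fun x => x ∘ v) w s y ^ 2 := by
    unfold dev
    congr!
  rw [this, Finset.mul_sum]
  calc _ ≤ ∑ s : Fin m → A, pr P (fun x => x ∘ v = s) *
      ((lam * (Fintype.card A : ℝ) ^ k * J ^ 2 +
        lam⁻¹ * ∑ y, del P (fun x => x ∘ v) w s y ^ 2) / 2) := by
        refine Finset.sum_le_sum fun s _ => ?_
        rw [mul_left_comm]
        exact mul_le_mul_of_nonneg_left (key2 s) (pr_nonneg hP _)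
    _ = ((∑ s : Fin m → A, pr P (fun x => x ∘ v = s)) * (lam * (Fintype.card A : ℝ) ^ k * J ^ 2)
      + lam⁻¹ * ∑ s : Fin m → A, pr P (fun x => x ∘ v = s) *
      ∑ y, del P (fun x => x ∘ v) w s y ^ 2) / 2 := by
        rw [Finset.sum_mul, Finset.mul_sum, ← Finset.sum_add_distrib, Finset.sum_div]
        exact Finset.sum_congr rfl fun s _ => by ring
    _ = _ := by rw [h1, one_mul]

open Classical in
lemma total_error (fr : Frame d A) (hd : 0 < d) (a0 : A) (hn : 0 < n) {k : ℕ}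
    {K : ℝ} (hK0 : 0 ≤ K) (hK : ∀ a i j, ‖fr.D a i j‖ ≤ K)
    {ρ : Matrix (Fin n → Fin d) (Fin n → Fin d) ℂ} (hρ : IsDensity ρ)
    {E : Finset (Finset (Fin n))}
    {h : Finset (Fin n) → Matrix (Fin n → Fin d) (Fin n → Fin d) ℂ}
    (hE : ∀ e ∈ E, e.card = k) (hA : ∀ e ∈ E, ActsOn (h e) e) {m : ℕ} (v : Fin m → Fin n)
    {lam : ℝ} (hlam : 0 < lam) :
    |energy (∑ e ∈ E, h e) ρ - energy (∑ e ∈ E, h e) (sepState fr ρ v)| ≤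
      ((d : ℝ) ^ k * d ^ k * K ^ k) *
        (2 * ∑ e ∈ E, opNorm (h e) * (if ∃ i, v i ∈ e then 1 else 0) +
          (lam * (Fintype.card A : ℝ) ^ k * ∑ e ∈ E, opNorm (h e) ^ 2 +
            lam⁻¹ * ∑ w : Fin k → Fin n, dev (outc fr ρ) (fun x => x ∘ v) w) / 2) := by
  obtain ⟨we, hwe⟩ := exists_enum hn k
  have hP := outc_nonneg fr hρ.1
  have hC : (0 : ℝ) ≤ (d : ℝ) ^ k * d ^ k * K ^ k := by positivity
  rw [energy_sum_left, energy_sum_left, ← Finset.sum_sub_distrib]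
  refine (Finset.abs_sum_le_sum_abs _ _).trans ?_
  have step : ∀ e ∈ E, |energy (h e) ρ - energy (h e) (sepState fr ρ v)| ≤
      ((d : ℝ) ^ k * d ^ k * K ^ k) * (2 * (opNorm (h e) * (if ∃ i, v i ∈ e then 1 else 0)) +
        (lam * (Fintype.card A : ℝ) ^ k * opNorm (h e) ^ 2 +
          lam⁻¹ * dev (outc fr ρ) (fun x => x ∘ v) (we e)) / 2) := by
    intro e he
    have h1 := edge_error fr hd a0 hρ v (hA e he) (hwe e (hE e he)).1 (hwe e (hE e he)).2
      (fun x => sym_bound fr hd hK (hE e he) (hA e he) x)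
    have h2 := amgm hP v (pr_pin_sum fr hρ v) (we e) (opNorm (h e)) lam hlam
    refine h1.trans ?_
    rw [mul_assoc]
    refine mul_le_mul_of_nonneg_left ?_ hC
    rw [mul_add]
    linarith
  refine (Finset.sum_le_sum step).trans ?_
  rw [← Finset.mul_sum]
  refine mul_le_mul_of_nonneg_left ?_ hC
  rw [Finset.sum_add_distrib, ← Finset.mul_sum, ← Finset.sum_div, Finset.sum_add_distrib,
    ← Finset.mul_sum, ← Finset.mul_sum]
  have hinj : Set.InjOn we E := by
    intro e he f hf hef
    ext u
    rw [(hwe e (hE e he)).2, (hwe f (hE f hf)).2, hef]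
  have h3 : ∑ e ∈ E, dev (outc fr ρ) (fun x => x ∘ v) (we e) ≤
      ∑ w : Fin k → Fin n, dev (outc fr ρ) (fun x => x ∘ v) w := by
    rw [← Finset.sum_image (f := fun w => dev (outc fr ρ) (fun x => x ∘ v) w) hinj]
    exact Finset.sum_le_sum_of_subset_of_nonneg (Finset.subset_univ _)
      fun w _ _ => dev_nonneg hP _ w
  have h4 := mul_le_mul_of_nonneg_left h3 (inv_nonneg.2 hlam.le)
  linarith

lemma averaged (fr : Frame d A) (hd : 0 < d) (a0 : A) (hn : 0 < n) {k : ℕ}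
    {K : ℝ} (hK0 : 0 ≤ K) (hK : ∀ a i j, ‖fr.D a i j‖ ≤ K)
    {ρ : Matrix (Fin n → Fin d) (Fin n → Fin d) ℂ} (hρ : IsDensity ρ)
    {E : Finset (Finset (Fin n))}
    {h : Finset (Fin n) → Matrix (Fin n → Fin d) (Fin n → Fin d) ℂ}
    (hE : ∀ e ∈ E, e.card = k) (hA : ∀ e ∈ E, ActsOn (h e) e) {l : ℕ} (hl : 0 < l)
    {lam : ℝ} (hlam : 0 < lam) :
    ∃ (m : ℕ) (v : Fin m → Fin n),
    |energy (∑ e ∈ E, h e) ρ - energy (∑ e ∈ E, h e) (sepState fr ρ v)| ≤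
      ((d : ℝ) ^ k * d ^ k * K ^ k) *
        (2 * k * ((l : ℝ) / n * ∑ e ∈ E, opNorm (h e)) +
          (lam * (Fintype.card A : ℝ) ^ k * ∑ e ∈ E, opNorm (h e) ^ 2 +
            lam⁻¹ * ((n : ℝ) ^ k / l) * (4 ^ k * k)) / 2) := by
  classical
  have hC : (0 : ℝ) ≤ (d : ℝ) ^ k * d ^ k * K ^ k := by positivity
  have hn' : (0 : ℝ) < n := by exact_mod_cast hn
  have hl' : (0 : ℝ) < l := by exact_mod_cast hl
  have hP := outc_nonneg fr hρ.1
  have hsum := sum_avgDev hn hP (outc_sum fr hρ) l k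
  refine pigeon hn l hl (fun m v =>
    |energy (∑ e ∈ E, h e) ρ - energy (∑ e ∈ E, h e) (sepState fr ρ v)|) _ ?_
  have stepm : ∀ m ∈ Finset.range l, ((n : ℝ) ^ m)⁻¹ * ∑ v : Fin m → Fin n,
      |energy (∑ e ∈ E, h e) ρ - energy (∑ e ∈ E, h e) (sepState fr ρ v)| ≤
      ((d : ℝ) ^ k * d ^ k * K ^ k) *
        (2 * k * ((l : ℝ) / n * ∑ e ∈ E, opNorm (h e)) +
          (lam * (Fintype.card A : ℝ) ^ k * ∑ e ∈ E, opNorm (h e) ^ 2 +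
            lam⁻¹ * ((n : ℝ) ^ k * avgDev (outc fr ρ) k m)) / 2) := by
    intro m hm
    have hml : (m : ℝ) ≤ l := by exact_mod_cast (Finset.mem_range.1 hm).le
    have hnm : (0 : ℝ) < (n : ℝ) ^ m := by positivity
    refine (mul_le_mul_of_nonneg_left (Finset.sum_le_sum fun v _ =>
      total_error fr hd a0 hn hK0 hK hρ hE hA v hlam) (inv_nonneg.2 hnm.le)).trans ?_
    rw [← Finset.mul_sum, mul_left_comm]
    refine mul_le_mul_of_nonneg_left ?_ hC
    have a0' : ∑ v : Fin m → Fin n, ∑ e ∈ E, opNorm (h e) * (if ∃ i, v i ∈ e then (1 : ℝ) else 0) =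
        ∑ e ∈ E, opNorm (h e) *
        ∑ v : Fin m → Fin n, (if ∃ i, v i ∈ e then (1 : ℝ) else 0) := by
      rw [Finset.sum_comm]
      simp only [Finset.mul_sum]
    rw [Finset.sum_add_distrib, ← Finset.mul_sum, ← Finset.sum_div, Finset.sum_add_distrib,
      ← Finset.mul_sum _ _ lam⁻¹, a0']
    have a1 : (n : ℝ) ^ k * avgDev (outc fr ρ) k m = ((n : ℝ) ^ m)⁻¹ *
        ∑ v : Fin m → Fin n, ∑ w : Fin k → Fin n, dev (outc fr ρ) (fun x => x ∘ v) w := by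
      have : avgDev (outc fr ρ) k m = ((n : ℝ) ^ (m + k))⁻¹ *
        ∑ v : Fin m → Fin n, ∑ w : Fin k → Fin n, dev (outc fr ρ) (fun x => x ∘ v) w := rfl
      rw [this, pow_add]
      field_simp
    have a2 : ((n : ℝ) ^ m)⁻¹ * ∑ e ∈ E, opNorm (h e) *
        ∑ v : Fin m → Fin n, (if ∃ i, v i ∈ e then (1 : ℝ) else 0) ≤
        k * ((l : ℝ) / n * ∑ e ∈ E, opNorm (h e)) := by
      rw [Finset.mul_sum, Finset.mul_sum, Finset.mul_sum]
      refine Finset.sum_le_sum fun e he => ?_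
      rw [mul_left_comm]
      have b1 := hit_sum hn m e
      rw [hE e he] at b1
      have b2 : (m : ℝ) * k / n ≤ k * ((l : ℝ) / n) := by
        rw [mul_comm (m : ℝ), mul_div_assoc]
        gcongr
      have := mul_le_mul_of_nonneg_left (b1.trans b2) (opNorm_nonneg' (h e))
      linarith
    have a3 : ((n : ℝ) ^ m)⁻¹ * ∑ v : Fin m → Fin n,
        lam * (Fintype.card A : ℝ) ^ k * ∑ e ∈ E, opNorm (h e) ^ 2 =
        lam * (Fintype.card A : ℝ) ^ k * ∑ e ∈ E, opNorm (h e) ^ 2 := by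
      simp only [Finset.sum_const, Finset.card_univ, Fintype.card_fun, Fintype.card_fin,
        nsmul_eq_mul]
      push_cast
      field_simp
    rw [a1, mul_add, mul_div_assoc', mul_add, a3]
    linarith [a2]
  refine (Finset.sum_le_sum stepm).trans ?_
  rw [← Finset.mul_sum, mul_left_comm (l : ℝ)]
  refine mul_le_mul_of_nonneg_left ?_ hC
  rw [Finset.sum_add_distrib, ← Finset.sum_div, Finset.sum_add_distrib,
    ← Finset.mul_sum _ _ lam⁻¹, ← Finset.mul_sum _ _ ((n : ℝ) ^ k)]
  simp only [Finset.sum_const, Finset.card_range, nsmul_eq_mul]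
  have b := mul_le_mul_of_nonneg_left hsum (show 0 ≤ lam⁻¹ * (n : ℝ) ^ k by positivity)
  have c : (l : ℝ) * (lam⁻¹ * ((n : ℝ) ^ k / l) * (4 ^ k * k)) =
    lam⁻¹ * (n : ℝ) ^ k * (4 ^ k * k) := by field_simp
  linarith [b, c]

end Final

/-- For all fixed `k` and `d` there is a constant `C` such that for every
`k`-local Hamiltonian on `n` qudits of local dimension `d` (no bound on the interaction
norms), every `n`-qudit density matrix `ρ`, and every integer `1 ≤ l < n`, there is a
separable state `σ` with
`|Tr[Hρ] − Tr[Hσ]| ≤ C·((l/n)·|J|₁ + (n^{k/2}/√l)·‖J‖_F)`, where `J_e = ‖h_e‖_∞`. -/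
theorem separable_state_energy_approximation :
    ∀ k d : ℕ, 0 < k → 0 < d → ∃ C : ℝ, 0 < C ∧
      ∀ (n : ℕ) (E : Finset (Finset (Fin n)))
        (h : Finset (Fin n) → Matrix (Fin n → Fin d) (Fin n → Fin d) ℂ),
        (∀ e ∈ E, e.card = k) →
        (∀ e ∈ E, (h e).IsHermitian) →
        (∀ e ∈ E, ActsOn (h e) e) →
        ∀ ρ : Matrix (Fin n → Fin d) (Fin n → Fin d) ℂ, IsDensity ρ →
        ∀ l : ℕ, 1 ≤ l → l < n →
        ∃ σ : Matrix (Fin n → Fin d) (Fin n → Fin d) ℂ, IsSeparable σ ∧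
          |energy (∑ e ∈ E, h e) ρ - energy (∑ e ∈ E, h e) σ| ≤
            C * (((l : ℝ) / n) * (∑ e ∈ E, opNorm (h e)) +
              ((n : ℝ) ^ ((k : ℝ) / 2) / Real.sqrt l) *
                Real.sqrt (∑ e ∈ E, (opNorm (h e)) ^ 2)) := by
  intro k d _ hd
  obtain ⟨fr⟩ := exists_frame d hd
  obtain ⟨K, hK0, hK⟩ : ∃ K : ℝ, 0 ≤ K ∧ ∀ a i j, ‖fr.D a i j‖ ≤ K := by
    refine ⟨∑ a, ∑ i, ∑ j, ‖fr.D a i j‖, by positivity, fun a i j => ?_⟩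
    calc ‖fr.D a i j‖ ≤ ∑ j, ‖fr.D a i j‖ :=
          Finset.single_le_sum (f := fun j => ‖fr.D a i j‖) (fun _ _ => norm_nonneg _)
            (Finset.mem_univ j)
      _ ≤ ∑ i, ∑ j, ‖fr.D a i j‖ :=
          Finset.single_le_sum (f := fun i => ∑ j, ‖fr.D a i j‖) (fun _ _ => by positivity)
            (Finset.mem_univ i)
      _ ≤ _ :=
          Finset.single_le_sum (f := fun a => ∑ i, ∑ j, ‖fr.D a i j‖) (fun _ _ => by positivity)
            (Finset.mem_univ a)
  set c : ℝ := (d : ℝ) ^ k * d ^ k * K ^ k with hc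
  set N : ℝ := (Fintype.card (Fin d × Fin d × Fin 4) : ℝ) ^ k with hN
  have hc0 : 0 ≤ c := by positivity
  have hN0 : 0 ≤ N := by positivity
  refine ⟨c * (2 * k + N + 4 ^ k * k) + 1, by positivity, ?_⟩
  intro n E h hE _ hA ρ hρ l hl hln
  have hn : 0 < n := by omega
  have hn' : (0 : ℝ) < n := by exact_mod_cast hn
  have hl' : (0 : ℝ) < l := by exact_mod_cast hl
  have hS1 : 0 ≤ ∑ e ∈ E, opNorm (h e) := Finset.sum_nonneg fun e _ => opNorm_nonneg' _
  have hS2 : 0 ≤ ∑ e ∈ E, opNorm (h e) ^ 2 := Finset.sum_nonneg fun e _ => sq_nonneg _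
  let a0 : Fin d × Fin d × Fin 4 := (⟨0, hd⟩, ⟨0, hd⟩, 0)
  set t : ℝ := (n : ℝ) ^ ((k : ℝ) / 2) / Real.sqrt l with ht
  have ht0 : 0 < t := by positivity
  have ht2 : t ^ 2 = (n : ℝ) ^ k / l := by
    rw [ht, div_pow, Real.sq_sqrt hl'.le, ← Real.rpow_natCast, ← Real.rpow_mul hn'.le]
    norm_num
  set F : ℝ := Real.sqrt (∑ e ∈ E, opNorm (h e) ^ 2) with hF
  have hF2 : ∑ e ∈ E, opNorm (h e) ^ 2 = F ^ 2 := (Real.sq_sqrt hS2).symm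
  have hF0 : 0 ≤ F := Real.sqrt_nonneg _
  rcases hF0.eq_or_lt with h0 | hpos
  · have hz : ∀ e ∈ E, opNorm (h e) = 0 := by
      rw [← h0, zero_pow two_ne_zero,
        Finset.sum_eq_zero_iff_of_nonneg fun e _ => sq_nonneg _] at hF2
      intro e he
      simpa using hF2 e he
    have hz1 : ∑ e ∈ E, opNorm (h e) = 0 := Finset.sum_eq_zero hz
    obtain ⟨we, hwe⟩ := exists_enum hn k
    refine ⟨sepState fr ρ (Fin.elim0 : Fin 0 → Fin n), sepState_sep fr hd hρ _, ?_⟩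
    rw [energy_sum_left, energy_sum_left, ← Finset.sum_sub_distrib, hz1, ← h0]
    refine (Finset.abs_sum_le_sum_abs _ _).trans ?_
    simp only [mul_zero, add_zero]
    refine Finset.sum_nonpos fun e he => ?_
    have h1 := edge_error fr hd a0 hρ (Fin.elim0 : Fin 0 → Fin n) (hA e he) (hwe e (hE e he)).1
      (hwe e (hE e he)).2 (fun x => sym_bound fr hd hK (hE e he) (hA e he) x)
    rwa [hz e he, mul_zero, zero_mul] at h1
  · obtain ⟨m, v, hv⟩ := averaged fr hd a0 hn hK0 hK hρ hE hA hl (lam := t / F) (by positivity)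
    refine ⟨sepState fr ρ v, sepState_sep fr hd hρ _, hv.trans ?_⟩
    rw [← hc, ← hN, ← ht2, hF2]
    have e1 : t / F * N * F ^ 2 = N * (t * F) := by field_simp
    have e2 : (t / F)⁻¹ * t ^ 2 * (4 ^ k * (k : ℝ)) = 4 ^ k * k * (t * F) := by field_simp
    rw [e1, e2]
    have hX : 0 ≤ (l : ℝ) / n * ∑ e ∈ E, opNorm (h e) := by positivity
    have hY : 0 ≤ t * F := by positivity
    generalize (l : ℝ) / n * ∑ e ∈ E, opNorm (h e) = X at *
    generalize t * F = Y at *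
    have hM : (0 : ℝ) ≤ 4 ^ k * k := by positivity
    have hk : (0 : ℝ) ≤ k := by positivity
    generalize (4 : ℝ) ^ k * k = M at *
    have h1 : 2 * k * X + (N * Y + M * Y) / 2 ≤ (2 * k + N + M) * (X + Y) := by
      nlinarith [mul_nonneg hN0 hX, mul_nonneg hM hX, mul_nonneg hN0 hY, mul_nonneg hM hY,
        mul_nonneg hk hY]
    have h2 := mul_le_mul_of_nonneg_left h1 hc0
    linarith

end QLH
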